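/- arXiv:2410.07557 — 3 statements merged into one kernel-verified Lean document; each statement's English description precedes it below -/
import Mathlib

section
/- For every integer d ≥ 2, every norm ‖·‖ on ℝ^d, and every real ε > 0, there exists N such that for every integer n ≥ N there is a set S ⊆ ℝ^d of exactly n points spanning at least (d/2 − ε)·n·log₂ n unit distances under ‖·‖. -/
open scoped Pointwise Classical

/-- A function `N : ℝ^d → ℝ` is a norm. -/
def IsNorm {d : ℕ} (N : EuclideanSpace ℝ (Fin d) → ℝ) : Prop :=
  (∀ x y, N (x + y) ≤ N x + N y) ∧
  (∀ (a : ℝ) (x : EuclideanSpace ℝ (Fin d)), N (a • x) = |a| * N x) ∧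
  (∀ x, N x = 0 ↔ x = 0)

/-- The ordered pairs of distinct points of `S` at `N`-distance one. -/
noncomputable def unitPairs {E : Type*} [AddCommGroup E] (N : E → ℝ) (S : Finset E) :
    Finset (E × E) :=
  (S ×ˢ S).filter fun p => p.1 ≠ p.2 ∧ N (p.1 - p.2) = 1

section Combinatorics

variable {E : Type*} [AddCommGroup E] {N : E → ℝ}

lemma mem_unitPairs (h0 : N 0 = 0) {S : Finset E} {p : E × E} :
    p ∈ unitPairs N S ↔ p.1 ∈ S ∧ p.2 ∈ S ∧ N (p.1 - p.2) = 1 := by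
  simp only [unitPairs, Finset.mem_filter, Finset.mem_product]
  constructor
  · rintro ⟨⟨h1, h2⟩, -, h3⟩
    exact ⟨h1, h2, h3⟩
  · rintro ⟨h1, h2, h3⟩
    refine ⟨⟨h1, h2⟩, fun h => ?_, h3⟩
    rw [h, sub_self, h0] at h3
    exact zero_ne_one h3

lemma unitPairs_mono (h0 : N 0 = 0) {S T : Finset E} (h : S ⊆ T) :
    unitPairs N S ⊆ unitPairs N T := fun p hp => by
  rw [mem_unitPairs h0] at hp ⊢
  exact ⟨h hp.1, h hp.2.1, hp.2.2⟩

lemma card_mul_card_le_card_unitPairs (h0 : N 0 = 0) {Q S W : Finset E}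
    (hW : ∀ w ∈ W, N w = 1) (hQS : Q ⊆ S) (hadd : ∀ x ∈ Q, ∀ w ∈ W, x + w ∈ S) :
    Q.card * W.card ≤ (unitPairs N S).card := by
  rw [← Finset.card_product]
  refine Finset.card_le_card_of_injOn (fun p => (p.1 + p.2, p.1)) ?_ ?_
  · rintro ⟨x, w⟩ hp
    obtain ⟨hx, hw⟩ := Finset.mem_product.1 hp
    refine (mem_unitPairs h0).2 ⟨hadd x hx w hw, hQS hx, ?_⟩
    simpa using hW w hw
  · rintro ⟨x, w⟩ - ⟨x', w'⟩ - h
    simp only [Prod.mk.injEq] at h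
    obtain ⟨h1, rfl⟩ := h
    simpa using h1

/-- The image of a symmetric box under integer linear combinations of a family. -/
noncomputable def boxSpan {ι : Type*} [Fintype ι] (y : ι → E) (L : ℕ) : Finset E :=
  (Fintype.piFinset fun _ : ι => Finset.Icc (-(L : ℤ)) L).image fun a => ∑ i, a i • y i

lemma mem_boxSpan {ι : Type*} [Fintype ι] {y : ι → E} {L : ℕ} {x : E} :
    x ∈ boxSpan y L ↔ ∃ a : ι → ℤ, (∀ i, |a i| ≤ L) ∧ ∑ i, a i • y i = x := by
  simp [boxSpan, abs_le]

lemma card_boxSpan_le {ι : Type*} [Fintype ι] (y : ι → E) (L : ℕ) :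
    (boxSpan y L).card ≤ (2 * L + 1) ^ Fintype.card ι := by
  refine Finset.card_image_le.trans_eq ?_
  rw [Fintype.card_piFinset, Finset.prod_const, Int.card_Icc, Finset.card_univ]
  congr 1
  omega

lemma add_mem_boxSpan {ι : Type*} [Fintype ι] {y : ι → E} {L L' : ℕ} {x x' : E}
    (hx : x ∈ boxSpan y L) (hx' : x' ∈ boxSpan y L') : x + x' ∈ boxSpan y (L + L') := by
  obtain ⟨a, ha, rfl⟩ := mem_boxSpan.1 hx
  obtain ⟨b, hb, rfl⟩ := mem_boxSpan.1 hx'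
  refine mem_boxSpan.2 ⟨a + b, fun i => ?_, by simp [add_smul, Finset.sum_add_distrib]⟩
  push_cast
  exact (abs_add_le _ _).trans (add_le_add (ha i) (hb i))

/-- Many unit vectors with small coefficients over few generators give a set with many unit
distances: some dilate of the box of generators grows slowly. -/
lemma exists_card_unitPairs_of_mem_boxSpan (h0 : N 0 = 0) {ι : Type*} [Fintype ι] (y : ι → E)
    {M T : ℕ} {W : Finset E} (hW : ∀ w ∈ W, N w = 1) (hrep : ∀ w ∈ W, w ∈ boxSpan y M)
    (hT : (2 * (T * M) + 1) ^ Fintype.card ι < 2 ^ T) :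
    ∃ P : Finset E, P.Nonempty ∧ P.card ≤ 2 ^ T ∧
      P.card * W.card ≤ 2 * (unitPairs N P).card := by
  have hzero : ∀ L, (0 : E) ∈ boxSpan y L := fun L => mem_boxSpan.2 ⟨0, by simp, by simp⟩
  have hgrow : ∃ L < T, (boxSpan y ((L + 1) * M)).card ≤ 2 * (boxSpan y (L * M)).card := by
    by_contra! hcon
    have hpow : ∀ L ≤ T, 2 ^ L ≤ (boxSpan y (L * M)).card := by
      intro L
      induction L with
      | zero => exact fun _ => Finset.card_pos.2 ⟨0, hzero _⟩
      | succ L ih =>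
        intro hL
        have := hcon L hL
        have := ih (by omega)
        rw [pow_succ]
        omega
    exact absurd ((hpow T le_rfl).trans (card_boxSpan_le y _)) (not_le.2 hT)
  obtain ⟨L, hL, hcard⟩ := hgrow
  have hadd : ∀ x ∈ boxSpan y (L * M), ∀ w ∈ W, x + w ∈ boxSpan y ((L + 1) * M) := by
    intro x hx w hw
    rw [add_one_mul]
    exact add_mem_boxSpan hx (hrep w hw)
  have hsub : boxSpan y (L * M) ⊆ boxSpan y ((L + 1) * M) := by
    intro x hx
    rw [add_one_mul]
    simpa using add_mem_boxSpan hx (hzero M)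
  refine ⟨boxSpan y ((L + 1) * M), ⟨0, hzero _⟩, ?_, ?_⟩
  · refine (card_boxSpan_le y _).trans (le_trans ?_ hT.le)
    gcongr
    omega
  · have := card_mul_card_le_card_unitPairs h0 hW hsub hadd
    calc _ ≤ 2 * (boxSpan y (L * M)).card * W.card := by gcongr
      _ ≤ _ := by rw [mul_assoc]; gcongr

/-- Minkowski sums add up average degrees when all sums are distinct. -/
lemma card_unitPairs_add (h0 : N 0 = 0) {S A : Finset E} {G : AddSubgroup E}
    (hS : ∀ x ∈ S, x ∈ G) (hA : ∀ x ∈ A, ∀ y ∈ A, x - y ∈ G → x = y) :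
    (S + A).card = S.card * A.card ∧
      (unitPairs N S).card * A.card + S.card * (unitPairs N A).card ≤
        (unitPairs N (S + A)).card := by
  have hinj : ∀ x ∈ S, ∀ y ∈ S, ∀ a ∈ A, ∀ b ∈ A, x + a = y + b → x = y ∧ a = b := by
    intro x hx y hy a ha b hb h
    have hab : a = b := hA a ha b hb (by
      rw [show a - b = y - x by rw [sub_eq_sub_iff_add_eq_add, add_comm, h]]
      exact G.sub_mem (hS y hy) (hS x hx))
    subst hab
    exact ⟨add_right_cancel h, rfl⟩
  refine ⟨Finset.card_add_iff.2 ?_, ?_⟩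
  · rintro ⟨x, a⟩ ⟨hx, ha⟩ ⟨y, b⟩ ⟨hy, hb⟩ h
    exact Prod.ext_iff.2 (hinj x hx y hy a ha b hb h)
  set I := (unitPairs N S ×ˢ A).image fun q => (q.1.1 + q.2, q.1.2 + q.2) with hI
  set K := (S ×ˢ unitPairs N A).image fun q => (q.1 + q.2.1, q.1 + q.2.2) with hK
  have hIcard : I.card = (unitPairs N S).card * A.card := by
    rw [hI, Finset.card_image_of_injOn, Finset.card_product]
    rintro ⟨⟨x, y⟩, a⟩ hq ⟨⟨x', y'⟩, a'⟩ hq' h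
    simp only [Finset.coe_product, Set.mem_prod, Finset.mem_coe, mem_unitPairs h0] at hq hq'
    simp only [Prod.mk.injEq] at h
    obtain ⟨rfl, rfl⟩ := hinj x hq.1.1 x' hq'.1.1 a hq.2 a' hq'.2 h.1
    obtain ⟨rfl, -⟩ := hinj y hq.1.2.1 y' hq'.1.2.1 a hq.2 a hq'.2 h.2
    rfl
  have hKcard : K.card = S.card * (unitPairs N A).card := by
    rw [hK, Finset.card_image_of_injOn, Finset.card_product]
    rintro ⟨x, ⟨a, b⟩⟩ hq ⟨x', ⟨a', b'⟩⟩ hq' h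
    simp only [Finset.coe_product, Set.mem_prod, Finset.mem_coe, mem_unitPairs h0] at hq hq'
    simp only [Prod.mk.injEq] at h
    obtain ⟨rfl, rfl⟩ := hinj x hq.1 x' hq'.1 a hq.2.1 a' hq'.2.1 h.1
    obtain ⟨-, rfl⟩ := hinj x hq.1 x hq'.1 b hq.2.2.1 b' hq'.2.2.1 h.2
    rfl
  have hdisj : Disjoint I K := by
    rw [Finset.disjoint_left]
    intro p hpI hpK
    obtain ⟨⟨⟨x, y⟩, a⟩, hq, rfl⟩ := Finset.mem_image.1 hpI
    obtain ⟨⟨z, ⟨b, c⟩⟩, hq', h⟩ := Finset.mem_image.1 hpK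
    simp only [Finset.mem_product, mem_unitPairs h0] at hq hq'
    simp only [Prod.mk.injEq] at h
    obtain ⟨h1, -⟩ := hinj z hq'.1 x hq.1.1 b hq'.2.1 a hq.2 h.1
    obtain ⟨h2, -⟩ := hinj z hq'.1 y hq.1.2.1 c hq'.2.2.1 a hq.2 h.2
    have := hq.1.2.2
    rw [← h1, ← h2, sub_self, h0] at this
    exact zero_ne_one this
  rw [← hIcard, ← hKcard, ← Finset.card_union_of_disjoint hdisj]
  refine Finset.card_le_card (Finset.union_subset ?_ ?_)
  · intro p hp
    obtain ⟨⟨⟨x, y⟩, a⟩, hq, rfl⟩ := Finset.mem_image.1 hp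
    simp only [Finset.mem_product, mem_unitPairs h0] at hq
    refine (mem_unitPairs h0).2 ⟨Finset.add_mem_add hq.1.1 hq.2,
      Finset.add_mem_add hq.1.2.1 hq.2, ?_⟩
    simpa using hq.1.2.2
  · intro p hp
    obtain ⟨⟨x, ⟨a, b⟩⟩, hq, rfl⟩ := Finset.mem_image.1 hp
    simp only [Finset.mem_product, mem_unitPairs h0] at hq
    refine (mem_unitPairs h0).2 ⟨Finset.add_mem_add hq.1 hq.2.1,
      Finset.add_mem_add hq.1 hq.2.2.1, ?_⟩
    simpa using hq.2.2.2

/-- Blocks independent of any prescribed countable subgroup can be summed up. -/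
lemma exists_card_unitPairs_of_blocks (h0 : N 0 = 0) {a e : ℕ}
    (hblock : ∀ G : AddSubgroup E, Countable G → ∃ A : Finset E, A.card = a ∧
      (∀ x ∈ A, ∀ y ∈ A, x - y ∈ G → x = y) ∧ e ≤ (unitPairs N A).card) (s : ℕ) :
    ∃ P : Finset E, P.card = a ^ s ∧ s * e * P.card ≤ (unitPairs N P).card * a := by
  induction s with
  | zero => exact ⟨{0}, by simp, by simp⟩
  | succ s ih =>
    obtain ⟨P, hP, hPe⟩ := ih
    have hcount : Countable (Submodule.span ℤ (Set.range ((↑) : P → E))) := inferInstance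
    obtain ⟨A, hA, hAG, hAe⟩ := hblock
      (Submodule.span ℤ (Set.range ((↑) : P → E))).toAddSubgroup hcount
    have hPG : ∀ x ∈ P, x ∈ (Submodule.span ℤ (Set.range ((↑) : P → E))).toAddSubgroup :=
      fun x hx => Submodule.subset_span (Set.mem_range_self (⟨x, hx⟩ : P))
    obtain ⟨hcard, hpairs⟩ := card_unitPairs_add h0 hPG hAG
    refine ⟨P + A, by rw [hcard, hP, hA, pow_succ], ?_⟩
    rw [hcard, hA]
    rw [hA] at hpairs
    calc (s + 1) * e * (P.card * a) = (s * e * P.card) * a + P.card * e * a := by ring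
      _ ≤ ((unitPairs N P).card * a) * a + P.card * (unitPairs N A).card * a := by gcongr
      _ = ((unitPairs N P).card * a + P.card * (unitPairs N A).card) * a := by ring
      _ ≤ _ := by gcongr

/-- Disjoint translates multiply the number of unit distances. -/
lemma exists_card_unitPairs_copies [Infinite E] (h0 : N 0 = 0) (P : Finset E) (k : ℕ) :
    ∃ S : Finset E, S.card = k * P.card ∧ k * (unitPairs N P).card ≤ (unitPairs N S).card := by
  induction k with
  | zero => exact ⟨∅, by simp, by simp⟩
  | succ k ih =>
    obtain ⟨S, hS, hSe⟩ := ih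
    obtain ⟨v, hv⟩ := Infinite.exists_notMem_finset (S - P)
    have hdisj : Disjoint S (P.image (· + v)) := by
      rw [Finset.disjoint_left]
      intro x hx hx'
      obtain ⟨y, hy, rfl⟩ := Finset.mem_image.1 hx'
      exact hv (by simpa using Finset.sub_mem_sub hx hy)
    refine ⟨S ∪ P.image (· + v), ?_, ?_⟩
    · rw [Finset.card_union_of_disjoint hdisj,
        Finset.card_image_of_injective _ (add_left_injective v), hS, add_one_mul]
    · have hdisj' : Disjoint (unitPairs N S) (unitPairs N (P.image (· + v))) := by
        rw [Finset.disjoint_left]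
        intro p hp hp'
        rw [mem_unitPairs h0] at hp hp'
        exact Finset.disjoint_left.1 hdisj hp.1 hp'.1
      have htrans : (unitPairs N P).card ≤ (unitPairs N (P.image (· + v))).card := by
        refine Finset.card_le_card_of_injOn (fun p => (p.1 + v, p.2 + v)) ?_ ?_
        · intro p hp
          rw [Finset.mem_coe, mem_unitPairs h0] at hp ⊢
          exact ⟨Finset.mem_image_of_mem _ hp.1, Finset.mem_image_of_mem _ hp.2.1,
            by simpa using hp.2.2⟩
        · rintro ⟨x, y⟩ - ⟨x', y'⟩ - h
          simpa using h
      calc (k + 1) * (unitPairs N P).card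
          ≤ (unitPairs N S).card + (unitPairs N (P.image (· + v))).card := by
            rw [add_one_mul]; gcongr
        _ = (unitPairs N S ∪ unitPairs N (P.image (· + v))).card :=
            (Finset.card_union_of_disjoint hdisj').symm
        _ ≤ _ := Finset.card_le_card (Finset.union_subset
            (unitPairs_mono h0 Finset.subset_union_left)
            (unitPairs_mono h0 Finset.subset_union_right))

end Combinatorics

section Block

variable {E : Type*} [AddCommGroup E] {N : E → ℝ}

/-- A subset sum of `u` plus a combination of `V` with natural coefficients. -/
noncomputable def cubeBoxPoint {α κ : Type*} [Fintype α] [Fintype κ] (u : α → E) (V : κ → E)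
    (x : Finset α × (κ → ℕ)) : E :=
  ∑ a, (if a ∈ x.1 then (1 : ℤ) else 0) • u a + ∑ i, (x.2 i : ℤ) • V i

lemma cubeBoxPoint_sub {α κ : Type*} [Fintype α] [Fintype κ] (u : α → E) (V : κ → E)
    (x y : Finset α × (κ → ℕ)) :
    cubeBoxPoint u V x - cubeBoxPoint u V y =
      ∑ a, ((if a ∈ x.1 then (1 : ℤ) else 0) - (if a ∈ y.1 then (1 : ℤ) else 0)) • u a +
        ∑ i, ((x.2 i : ℤ) - y.2 i) • V i := by
  simp only [cubeBoxPoint, sub_smul, Finset.sum_sub_distrib]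
  abel

/-- The coefficients of the translation `V (inl l) + n • V (inr l)`. -/
def shiftCoeff {β : Type*} [DecidableEq β] (n : ℕ) (l : β) : β ⊕ β → ℕ :=
  Sum.elim (Pi.single l 1) (Pi.single l n)

lemma shiftCoeff_injective {β : Type*} [DecidableEq β] (n : ℕ) :
    Function.Injective (shiftCoeff (β := β) n) := by
  intro l l' h
  have := congrFun h (Sum.inl l)
  by_contra hne
  simp [shiftCoeff, hne] at this

lemma sum_shiftCoeff_smul {β : Type*} [Fintype β] [DecidableEq β] (V : β ⊕ β → E) (n : ℕ)
    (l : β) : ∑ i, (shiftCoeff n l i : ℤ) • V i = V (Sum.inl l) + n • V (Sum.inr l) := by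
  simp [shiftCoeff, Pi.single_apply, Fintype.sum_sum_type]

/-- The sum of a cube spanned by the `u a` and a box spanned by the `V i` has many unit
distances if many translates `u a + V (inl l) + n a • V (inr l)` are unit vectors. -/
lemma exists_block (h0 : N 0 = 0) (hneg : ∀ x, N (-x) = N x) {α β : Type*} [Fintype α]
    [Fintype β] {G : AddSubgroup E} {u : α → E} {V : β ⊕ β → E} {n : α → ℕ} {J M : ℕ}
    (hn : ∀ a, n a < J) (hJ : J ≤ M)
    (hunit : ∀ a l, N (u a + V (Sum.inl l) + n a • V (Sum.inr l)) = 1)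
    (hind : ∀ δ : α → ℤ, (∀ a, |δ a| ≤ 1) → ∀ k : β ⊕ β → ℤ, (∀ i, |k i| ≤ M) →
      ∑ a, δ a • u a + ∑ i, k i • V i ∈ G → δ = 0 ∧ k = 0) :
    ∃ A : Finset E,
      A.card = 2 ^ Fintype.card α * (M + 1) ^ (2 * Fintype.card β) ∧
      (∀ x ∈ A, ∀ y ∈ A, x - y ∈ G → x = y) ∧
      2 ^ Fintype.card α * (M + 1 - J) ^ (2 * Fintype.card β) *
        (Fintype.card α * Fintype.card β) ≤ (unitPairs N A).card := by
  set X : Finset (Finset α × (β ⊕ β → ℕ)) :=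
    Finset.univ ×ˢ Fintype.piFinset fun _ => Finset.range (M + 1) with hX
  have memX : ∀ x, x ∈ X ↔ ∀ i, x.2 i ≤ M := by
    intro x
    simp [hX]
  have hsep : ∀ x ∈ X, ∀ y ∈ X, cubeBoxPoint u V x - cubeBoxPoint u V y ∈ G → x = y := by
    intro x hx y hy hxy
    rw [cubeBoxPoint_sub] at hxy
    rw [memX] at hx hy
    obtain ⟨h1, h2⟩ := hind _ (fun a => by split_ifs <;> simp) _ (fun i => by
      have := hx i
      have := hy i
      rw [abs_le]
      constructor <;> omega) hxy
    refine Prod.ext (Finset.ext fun a => ?_) (funext fun i => ?_)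
    · have := congrFun h1 a
      by_cases ha : a ∈ x.1 <;> by_cases hb : a ∈ y.1 <;> simp_all
    · have := congrFun h2 i
      simp only [Pi.zero_apply] at this
      omega
  have hinj : Set.InjOn (cubeBoxPoint u V) X := fun x hx y hy h =>
    hsep x hx y hy (by rw [h, sub_self]; exact G.zero_mem)
  refine ⟨X.image (cubeBoxPoint u V), ?_, ?_, ?_⟩
  · rw [Finset.card_image_of_injOn hinj, hX, Finset.card_product, Fintype.card_piFinset]
    simp [two_mul]
  · intro x' hx' y' hy' hxy
    obtain ⟨x, hx, rfl⟩ := Finset.mem_image.1 hx'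
    obtain ⟨y, hy, rfl⟩ := Finset.mem_image.1 hy'
    rw [hsep x hx y hy hxy]
  set Y : Finset ((Finset α × (β ⊕ β → ℕ)) × (α × β)) :=
    (Finset.univ ×ˢ Fintype.piFinset fun _ => Finset.range (M + 1 - J)) ×ˢ Finset.univ with hY
  have hYcard : Y.card = 2 ^ Fintype.card α * (M + 1 - J) ^ (2 * Fintype.card β) *
      (Fintype.card α * Fintype.card β) := by
    rw [hY, Finset.card_product, Finset.card_product, Fintype.card_piFinset]
    simp [two_mul]
  let src : (Finset α × (β ⊕ β → ℕ)) × (α × β) → Finset α × (β ⊕ β → ℕ) := fun q =>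
    (q.1.1, if q.2.1 ∈ q.1.1 then q.1.2 + shiftCoeff (n q.2.1) q.2.2 else q.1.2)
  let tgt : (Finset α × (β ⊕ β → ℕ)) × (α × β) → Finset α × (β ⊕ β → ℕ) := fun q =>
    (symmDiff q.1.1 {q.2.1},
      if q.2.1 ∈ q.1.1 then q.1.2 else q.1.2 + shiftCoeff (n q.2.1) q.2.2)
  have hshift : ∀ (a : α) (l : β) (i : β ⊕ β), shiftCoeff (n a) l i ≤ J := by
    intro a l i
    have := hn a
    rcases i with i | i <;> simp only [shiftCoeff, Sum.elim_inl, Sum.elim_inr, Pi.single_apply] <;>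
      split_ifs <;> omega
  have hbounds : ∀ q ∈ Y, src q ∈ X ∧ tgt q ∈ X := by
    rintro ⟨⟨s, m⟩, a, l⟩ hq
    simp only [hY, Finset.mem_product, Finset.mem_univ, true_and, and_true,
      Fintype.mem_piFinset, Finset.mem_range] at hq
    simp only [memX, src, tgt]
    constructor <;> intro i <;> have := hq i <;> have := hshift a l i <;> split_ifs <;>
      (try rw [Pi.add_apply]) <;> omega
  rw [← hYcard]
  refine Finset.card_le_card_of_injOn
    (fun q => (cubeBoxPoint u V (src q), cubeBoxPoint u V (tgt q))) ?_ ?_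
  · intro q hq
    obtain ⟨hl, hr⟩ := hbounds q hq
    refine (mem_unitPairs h0).2
      ⟨Finset.mem_image_of_mem _ hl, Finset.mem_image_of_mem _ hr, ?_⟩
    obtain ⟨⟨s, m⟩, a, l⟩ := q
    simp only [cubeBoxPoint_sub]
    have hunit' := hunit a l
    rw [add_assoc, ← sum_shiftCoeff_smul] at hunit'
    by_cases ha : a ∈ s
    · rw [← hunit']
      congr 2
      · rw [Finset.sum_eq_single a]
        · simp [src, tgt, ha, Finset.mem_symmDiff]
        · intro b _ hb
          simp [src, tgt, hb, Finset.mem_symmDiff]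
        · simp
      · simp [src, tgt, ha]
    · rw [← hunit', ← hneg, neg_add]
      congr 2
      · rw [Finset.sum_eq_single a]
        · simp [src, tgt, ha, Finset.mem_symmDiff]
        · intro b _ hb
          simp [src, tgt, hb, Finset.mem_symmDiff]
        · simp
      · simp [src, tgt, ha]
  · intro q hq q' hq' h
    simp only [Prod.mk.injEq] at h
    have hl := hinj (hbounds q hq).1 (hbounds q' hq').1 h.1
    have hr := hinj (hbounds q hq).2 (hbounds q' hq').2 h.2
    obtain ⟨⟨s, m⟩, a, l⟩ := q
    obtain ⟨⟨s', m'⟩, a', l'⟩ := q'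
    simp only [src, tgt, Prod.mk.injEq] at hl hr
    obtain ⟨rfl, hl⟩ := hl
    obtain ⟨ha, hr⟩ := hr
    obtain rfl : a = a' := Finset.singleton_injective (symmDiff_right_injective s ha)
    by_cases has : a ∈ s
    · simp only [has, if_true] at hl hr
      subst hr
      obtain rfl := shiftCoeff_injective _ (add_left_cancel hl)
      rfl
    · simp only [has, if_false] at hl hr
      subst hl
      obtain rfl := shiftCoeff_injective _ (add_left_cancel hr)
      rfl

end Block

section Analysis

open MeasureTheory Topology

lemma IsNorm.map_zero {d : ℕ} {N : EuclideanSpace ℝ (Fin d) → ℝ} (hN : IsNorm N) : N 0 = 0 :=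
  (hN.2.2 0).2 rfl

lemma IsNorm.map_neg {d : ℕ} {N : EuclideanSpace ℝ (Fin d) → ℝ} (hN : IsNorm N)
    (x : EuclideanSpace ℝ (Fin d)) : N (-x) = N x := by
  simpa using hN.2.1 (-1) x

lemma IsNorm.nonneg {d : ℕ} {N : EuclideanSpace ℝ (Fin d) → ℝ} (hN : IsNorm N)
    (x : EuclideanSpace ℝ (Fin d)) : 0 ≤ N x := by
  have h := hN.1 x (-x)
  rw [add_neg_cancel, hN.map_zero, hN.map_neg] at h
  linarith

lemma IsNorm.pos {d : ℕ} {N : EuclideanSpace ℝ (Fin d) → ℝ} (hN : IsNorm N)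
    {x : EuclideanSpace ℝ (Fin d)} (hx : x ≠ 0) : 0 < N x :=
  (hN.nonneg x).lt_of_ne fun h => hx ((hN.2.2 x).1 h.symm)

lemma IsNorm.convexOn {d : ℕ} {N : EuclideanSpace ℝ (Fin d) → ℝ} (hN : IsNorm N)
    {s : Set (EuclideanSpace ℝ (Fin d))} (hs : Convex ℝ s) : ConvexOn ℝ s N := by
  refine ⟨hs, fun x _ y _ a b ha hb _ => (hN.1 _ _).trans_eq ?_⟩
  rw [hN.2.1, hN.2.1, abs_of_nonneg ha, abs_of_nonneg hb, smul_eq_mul, smul_eq_mul]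

lemma IsNorm.exists_lipschitzWith {d : ℕ} {N : EuclideanSpace ℝ (Fin d) → ℝ} (hN : IsNorm N) :
    ∃ C, LipschitzWith C N := by
  have hsum : ∀ (s : Finset (Fin d)) (f : Fin d → EuclideanSpace ℝ (Fin d)),
      N (∑ i ∈ s, f i) ≤ ∑ i ∈ s, N (f i) := fun s f =>
    Finset.le_sum_of_subadditive N hN.map_zero.le hN.1 s f
  have hbound : ∀ x, N x ≤ (∑ i, N (EuclideanSpace.single i 1)) * ‖x‖ := by
    intro x
    have hx : x = ∑ i, x i • EuclideanSpace.single i (1 : ℝ) := by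
      ext j
      simp [Finset.sum_apply, Pi.single_apply]
    calc N x = N (∑ i, x i • EuclideanSpace.single i (1 : ℝ)) := by rw [← hx]
      _ ≤ ∑ i, N (x i • EuclideanSpace.single i (1 : ℝ)) := hsum _ _
      _ ≤ ∑ i, N (EuclideanSpace.single i 1) * ‖x‖ := by
        refine Finset.sum_le_sum fun i _ => ?_
        rw [hN.2.1, mul_comm]
        exact mul_le_mul_of_nonneg_left (PiLp.norm_apply_le x i) (hN.nonneg _)
      _ = _ := by rw [Finset.sum_mul]
  refine ⟨_, LipschitzWith.of_le_add_mul
    (Real.toNNReal (∑ i, N (EuclideanSpace.single i 1))) fun x y => ?_⟩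
  rw [Real.coe_toNNReal _ (Finset.sum_nonneg fun i _ => hN.nonneg _), dist_eq_norm]
  have h := hN.1 y (x - y)
  rw [add_sub_cancel] at h
  linarith [hbound (x - y)]

lemma IsNorm.continuous {d : ℕ} {N : EuclideanSpace ℝ (Fin d) → ℝ} (hN : IsNorm N) :
    Continuous N :=
  hN.exists_lipschitzWith.choose_spec.continuous

lemma IsNorm.volume_sphere {d : ℕ} {N : EuclideanSpace ℝ (Fin d) → ℝ} (hN : IsNorm N) :
    volume {x | N x = 1} = 0 := by
  have hconv : Convex ℝ {x | N x ≤ 1} := by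
    simpa using (hN.convexOn convex_univ).convex_le 1
  refine measure_mono_null (t := frontier {x | N x ≤ 1}) (fun x hx => ?_)
    (hconv.addHaar_frontier volume)
  have hx : N x = 1 := hx
  refine ⟨subset_closure hx.le, fun hint => ?_⟩
  have hcont : Filter.Tendsto (fun t : ℝ => t • x) (𝓝[>] 1) (𝓝 x) := by
    have : Filter.Tendsto (fun t : ℝ => t • x) (𝓝 1) (𝓝 ((1 : ℝ) • x)) :=
      (continuous_id.smul continuous_const).tendsto 1
    rw [one_smul] at this
    exact this.mono_left nhdsWithin_le_nhds
  obtain ⟨t, ht, ht1⟩ :=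
    ((hcont.eventually (mem_interior_iff_mem_nhds.1 hint)).and self_mem_nhdsWithin).exists
  have ht1 : (1 : ℝ) < t := ht1
  have ht : N (t • x) ≤ 1 := ht
  rw [hN.2.1, hx, mul_one, abs_of_pos (by linarith)] at ht
  linarith

/-- A convex function is strictly differentiable wherever it is differentiable. -/
lemma ConvexOn.hasStrictFDerivAt {E : Type*} [NormedAddCommGroup E] [NormedSpace ℝ E]
    {f : E → ℝ} (hf : ConvexOn ℝ Set.univ f) {p : E} {L : E →L[ℝ] ℝ} (h : HasFDerivAt f L p) :
    HasStrictFDerivAt f L p := by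
  refine .of_isLittleO ?_
  rw [Asymptotics.isLittleO_iff]
  intro c hc
  have hsmall := (hasFDerivAt_iff_isLittleO.1 h).def (show 0 < c / 4 by positivity)
  obtain ⟨r, hr, hball⟩ := Metric.eventually_nhds_iff_ball.1 hsmall
  set g : E → ℝ := fun x => f x - f p - L (x - p) with hg
  have hgconv : ConvexOn ℝ (Metric.ball p r) g := by
    have hlin : ConcaveOn ℝ Set.univ fun x => L x + (f p - L p) :=
      (L.toLinearMap.concaveOn convex_univ).add_const _
    refine ((hf.sub hlin).subset (Set.subset_univ _) (convex_ball p r)).congr fun x _ => ?_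
    simp only [hg, Pi.sub_apply, map_sub]
    ring
  have hgle : ∀ a, dist a p < r → |g a| ≤ c / 4 * r := by
    intro a ha
    refine (hball a ha).trans ?_
    rw [← dist_eq_norm]
    gcongr
  have hlip := hgconv.lipschitzOnWith_of_abs_le (show 0 < r / 2 by positivity) hgle
  rw [nhds_prod_eq]
  have hnear : Metric.ball p (r - r / 2) ∈ 𝓝 p := Metric.ball_mem_nhds p (by linarith)
  filter_upwards [Filter.prod_mem_prod hnear hnear] with q hq
  have h := hlip.dist_le_mul q.1 hq.1 q.2 hq.2
  rw [Real.dist_eq, dist_eq_norm, Real.coe_toNNReal _ (by positivity)] at h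
  have hc' : 2 * (c / 4 * r) / (r / 2) = c := by field_simp; norm_num
  rw [hc'] at h
  refine le_trans (le_of_eq ?_) h
  rw [Real.norm_eq_abs]
  congr 1
  simp only [hg, map_sub]
  ring

/-- Gradients of a norm at points of its unit sphere span the space. -/
lemma IsNorm.exists_gradients {d : ℕ} {N : EuclideanSpace ℝ (Fin d) → ℝ} (hN : IsNorm N) :
    ∃ (w : Fin d → EuclideanSpace ℝ (Fin d)) (L : Fin d → EuclideanSpace ℝ (Fin d) →L[ℝ] ℝ),
      (∀ i, N (w i) = 1 ∧ HasFDerivAt N (L i) (w i)) ∧ ∀ x, (∀ i, L i x = 0) → x = 0 := by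
  set s : Set (EuclideanSpace ℝ (Fin d)) :=
    {v | ∃ p, p ≠ 0 ∧ HasFDerivAt N (innerSL ℝ v) p} with hs
  have hspan : Submodule.span ℝ s = ⊤ := by
    rw [← Submodule.orthogonal_eq_bot_iff, Submodule.eq_bot_iff]
    intro h hh
    by_contra hne
    obtain ⟨C, hC⟩ := hN.exists_lipschitzWith
    have hdense : Dense {p | DifferentiableAt ℝ N p} :=
      Measure.dense_of_ae (μ := volume) hC.ae_differentiableAt
    have hopen : IsOpen {p | N (p + h) < N p} :=
      isOpen_lt (hN.continuous.comp (continuous_id.add continuous_const)) hN.continuous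
    obtain ⟨p, hp, hdiff⟩ := hdense.inter_open_nonempty _ hopen
      ⟨-h, by simpa [hN.map_zero, hN.map_neg] using hN.pos hne⟩
    have hp : N (p + h) < N p := hp
    have hp0 : p ≠ 0 := by
      rintro rfl
      rw [hN.map_zero] at hp
      exact absurd (hN.nonneg _) (not_le.2 hp)
    have hderiv := DifferentiableAt.hasFDerivAt hdiff
    set v := (InnerProductSpace.toDual ℝ (EuclideanSpace ℝ (Fin d))).symm (fderiv ℝ N p) with hv
    have hvp : innerSL ℝ v = fderiv ℝ N p := by
      ext x
      simp [hv]
    have hvh : fderiv ℝ N p h = 0 := by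
      rw [← hvp]
      exact (Submodule.mem_orthogonal _ h).1 hh v
        (Submodule.subset_span ⟨p, hp0, by rw [hvp]; exact hderiv⟩)
    have hline : HasDerivAt (fun t : ℝ => N (p + t • h)) 0 0 := by
      have h1 : HasDerivAt (fun t : ℝ => p + t • h) h 0 := by
        simpa using ((hasDerivAt_id (0 : ℝ)).smul_const h).const_add p
      have h2 : HasFDerivAt N (fderiv ℝ N p) (p + (0 : ℝ) • h) := by simpa using hderiv
      have h3 := h2.comp_hasDerivAt (0 : ℝ) h1
      rw [hvh] at h3
      exact h3
    have hconv : ConvexOn ℝ Set.univ fun t : ℝ => N (p + t • h) := by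
      refine ⟨convex_univ, fun x _ y _ a b ha hb hab => ?_⟩
      have := (hN.convexOn convex_univ).2 (Set.mem_univ (p + x • h)) (Set.mem_univ (p + y • h))
        ha hb hab
      have hcomb : p + (a • x + b • y) • h = a • (p + x • h) + b • (p + y • h) := by
        rw [smul_add, smul_add, add_add_add_comm, ← add_smul, hab, one_smul, add_smul,
          smul_assoc, smul_assoc]
      rw [← hcomb] at this
      exact this
    have hslope := hconv.le_slope_of_hasDerivAt (Set.mem_univ 0) (Set.mem_univ 1) one_pos hline
    simp [slope_def_field] at hslope
    linarith
  have hrank : Module.finrank ℝ (Submodule.span ℝ s) = d := by rw [hspan]; simp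
  obtain ⟨f, hf, hfspan, -⟩ := Submodule.exists_fun_fin_finrank_span_eq ℝ s
  choose p hp0 hp using hf
  refine ⟨fun i => (N (p (Fin.cast hrank.symm i)))⁻¹ • p (Fin.cast hrank.symm i),
    fun i => innerSL ℝ (f (Fin.cast hrank.symm i)), fun i => ⟨?_, ?_⟩, fun x hx => ?_⟩
  · have := hN.pos (hp0 (Fin.cast hrank.symm i))
    rw [hN.2.1, abs_of_pos (inv_pos.2 this), inv_mul_cancel₀ this.ne']
  · set q := p (Fin.cast hrank.symm i)
    have hq : 0 < N q := hN.pos (hp0 _)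
    have hscale : N = fun y => (N q)⁻¹ * N (N q • y) := by
      funext y
      rw [hN.2.1, abs_of_pos hq, inv_mul_cancel_left₀ hq.ne']
    have h1 : HasFDerivAt N (innerSL ℝ (f (Fin.cast hrank.symm i))) (N q • (N q)⁻¹ • q) := by
      rw [smul_inv_smul₀ hq.ne']
      exact hp _
    have h2 := (h1.comp ((N q)⁻¹ • q) ((hasFDerivAt_id _).const_smul (N q))).const_mul (N q)⁻¹
    have h3 : HasFDerivAt (fun y => (N q)⁻¹ * N (N q • y))
        (innerSL ℝ (f (Fin.cast hrank.symm i))) ((N q)⁻¹ • q) := by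
      refine h2.congr_fderiv ?_
      ext x
      simp [hq.ne']
    rwa [← hscale] at h3
  · have hx' : ∀ v ∈ Submodule.span ℝ (Set.range f), inner ℝ v x = 0 := by
      intro v hv
      induction hv using Submodule.span_induction with
      | mem v hv =>
        obtain ⟨i, rfl⟩ := hv
        simpa using hx (Fin.cast hrank i)
      | zero => simp
      | add a b _ _ ha hb => rw [inner_add_left, ha, hb, add_zero]
      | smul c a _ ha => rw [inner_smul_left, ha, mul_zero]
    rw [hfspan, hspan] at hx'
    exact inner_self_eq_zero.1 (hx' x trivial)

/-- There is an open family of configurations of `d` points that can be translated onto the unit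
sphere of a norm. -/
lemma IsNorm.exists_eventually_translate {d : ℕ} {N : EuclideanSpace ℝ (Fin d) → ℝ}
    (hN : IsNorm N) :
    ∃ w : Fin d → EuclideanSpace ℝ (Fin d),
      ∀ᶠ c in 𝓝 w, ∃ u : EuclideanSpace ℝ (Fin d), ∀ i, N (u + c i) = 1 := by
  obtain ⟨w, L, hwL, hL⟩ := hN.exists_gradients
  refine ⟨w, ?_⟩
  let Φ : (Fin d → EuclideanSpace ℝ (Fin d)) × EuclideanSpace ℝ (Fin d) →
      (Fin d → EuclideanSpace ℝ (Fin d)) × (Fin d → ℝ) :=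
    fun q => (q.1, fun i => N (q.2 + q.1 i))
  let sumAt : Fin d → (Fin d → EuclideanSpace ℝ (Fin d)) × EuclideanSpace ℝ (Fin d) →L[ℝ]
      EuclideanSpace ℝ (Fin d) := fun i =>
    ContinuousLinearMap.snd ℝ _ _ +
      (ContinuousLinearMap.proj i).comp (ContinuousLinearMap.fst ℝ _ _)
  let Φ' := (ContinuousLinearMap.fst ℝ (Fin d → EuclideanSpace ℝ (Fin d))
    (EuclideanSpace ℝ (Fin d))).prod (ContinuousLinearMap.pi fun i => (L i).comp (sumAt i))
  have hΦ : HasStrictFDerivAt Φ Φ' (w, 0) := by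
    refine HasStrictFDerivAt.prodMk hasStrictFDerivAt_fst (hasStrictFDerivAt_pi.2 fun i => ?_)
    have h1 : HasStrictFDerivAt N (L i) (sumAt i (w, 0)) := by
      refine (hN.convexOn convex_univ).hasStrictFDerivAt ?_
      simpa [sumAt] using (hwL i).2
    exact h1.comp (w, 0) (sumAt i).hasStrictFDerivAt
  have hinj : Function.Injective (LinearMap.pi fun i => (L i).toLinearMap) := by
    rw [← LinearMap.ker_eq_bot, LinearMap.ker_eq_bot']
    intro x hx
    exact hL x fun i => congrFun hx i
  have hsurj : Function.Surjective (LinearMap.pi fun i => (L i).toLinearMap) :=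
    (LinearMap.injective_iff_surjective_of_finrank_eq_finrank (by simp)).1 hinj
  have hrange : Φ'.range = ⊤ := by
    rw [LinearMap.range_eq_top]
    rintro ⟨c, y⟩
    obtain ⟨u, hu⟩ := hsurj fun i => y i - L i (c i)
    refine ⟨(c, u), Prod.ext rfl (funext fun i => ?_)⟩
    have := congrFun hu i
    simp only [LinearMap.pi_apply] at this
    simpa [Φ', sumAt] using eq_sub_iff_add_eq.1 this
  have hnhds : Set.range Φ ∈ 𝓝 (w, fun _ : Fin d => (1 : ℝ)) := by
    have : Φ (w, 0) = (w, fun _ => 1) := by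
      simp [Φ, fun i => (hwL i).1]
    rw [← this, ← hΦ.map_nhds_eq_of_surj hrange]
    exact Filter.range_mem_map
  have hcont : Filter.Tendsto (fun c : Fin d → EuclideanSpace ℝ (Fin d) =>
      (c, fun _ : Fin d => (1 : ℝ))) (𝓝 w) (𝓝 (w, fun _ => 1)) :=
    (Continuous.prodMk continuous_id continuous_const).tendsto w
  filter_upwards [hcont hnhds] with c hc
  obtain ⟨⟨c', u⟩, hq⟩ := hc
  simp only [Φ, Prod.mk.injEq] at hq
  obtain ⟨rfl, hq⟩ := hq
  exact ⟨u, fun i => congrFun hq i⟩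

end Analysis

section Dissociation

/-- No nontrivial combination of the `u a`, `a ∈ s`, with coefficients in `{-1, 0, 1}` lies in `G`
up to a combination of the `V i` with coefficients bounded by `M`. -/
def Dissociated {E α κ : Type*} [AddCommGroup E] [Fintype κ] (G : AddSubgroup E) (M : ℕ)
    (u : α → E) (V : κ → E) (s : Finset α) : Prop :=
  ∀ δ : α → ℤ, (∀ a, |δ a| ≤ 1) → ∀ k : κ → ℤ, (∀ i, |k i| ≤ M) →
    ∑ a ∈ s, δ a • u a + ∑ i, k i • V i ∈ G → ∀ a ∈ s, δ a = 0

lemma Dissociated.mono {E α κ : Type*} [AddCommGroup E] [Fintype κ] {G : AddSubgroup E} {M : ℕ}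
    {u : α → E} {V : κ → E} {s t : Finset α} (h : Dissociated G M u V t) (hst : s ⊆ t) :
    Dissociated G M u V s := by
  intro δ hδ k hk hmem a ha
  have := h (fun a => if a ∈ s then δ a else 0)
    (fun a => by split_ifs; exacts [hδ a, by simp]) k hk (by
      simpa [ite_smul, ← Finset.sum_filter, Finset.filter_mem_eq_inter,
        Finset.inter_eq_right.2 hst] using hmem) a (hst ha)
  simpa [ha] using this

/-- If no `R` of the vectors are dissociated, then all of them are small combinations of fewer than
`R` of them, modulo `G` and a box. -/
lemma exists_representation_of_not_dissociated {E α κ : Type*} [AddCommGroup E] [Fintype α]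
    [Fintype κ] {G : AddSubgroup E} {M R : ℕ} {u : α → E} {V : κ → E}
    (h : ∀ s : Finset α, s.card = R → ¬ Dissociated G M u V s) :
    ∃ s : Finset α, s.card < R ∧ ∀ j, ∃ g ∈ G, ∃ δ : α → ℤ, (∀ a, |δ a| ≤ 1) ∧
      ∃ k : κ → ℤ, (∀ i, |k i| ≤ M) ∧
        u j = g + (∑ a ∈ s, δ a • u a + ∑ i, k i • V i) := by
  obtain ⟨s, hs, hmax⟩ := Finset.exists_max_image
    (Finset.univ.filter fun s : Finset α => Dissociated G M u V s) Finset.card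
    ⟨∅, Finset.mem_filter.2 ⟨Finset.mem_univ _, fun _ _ _ _ _ a ha =>
      absurd ha (Finset.notMem_empty a)⟩⟩
  simp only [Finset.mem_filter, Finset.mem_univ, true_and] at hs hmax
  refine ⟨s, ?_, fun j => ?_⟩
  · by_contra! hR
    obtain ⟨t, hts, ht⟩ := Finset.exists_subset_card_eq hR
    exact h t ht (hs.mono hts)
  by_cases hj : j ∈ s
  · refine ⟨0, G.zero_mem, Pi.single j 1, fun a => ?_, 0, by simp, ?_⟩
    · by_cases ha : a = j
      · subst ha; simp
      · simp [ha]
    · simp [Pi.single_apply, ite_smul, hj]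
  have hins : ¬ Dissociated G M u V (insert j s) := fun hd => by
    have := hmax _ hd
    rw [Finset.card_insert_of_notMem hj] at this
    omega
  simp only [Dissociated] at hins
  push Not at hins
  obtain ⟨δ, hδ, k, hk, hmem, a, ha, hne⟩ := hins
  have hδj : δ j ≠ 0 := by
    intro hzero
    rw [Finset.sum_insert hj, hzero, zero_smul, zero_add] at hmem
    rcases Finset.mem_insert.1 ha with rfl | ha
    · exact hne hzero
    · exact hne (hs δ hδ k hk hmem a ha)
  have hsq : δ j * δ j = 1 := by
    have := abs_le.1 (hδ j)
    rcases (by omega : δ j = 1 ∨ δ j = -1) with h | h <;> rw [h] <;> norm_num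
  refine ⟨δ j • (∑ a ∈ insert j s, δ a • u a + ∑ i, k i • V i), G.zsmul_mem hmem _,
    fun a => -(δ j * δ a), fun a => ?_, fun i => -(δ j * k i), fun i => ?_, ?_⟩
  · rw [abs_neg, abs_mul]
    exact mul_le_one₀ (hδ j) (abs_nonneg _) (hδ a)
  · rw [abs_neg, abs_mul]
    exact (mul_le_of_le_one_left (abs_nonneg _) (hδ j)).trans (hk i)
  · rw [Finset.sum_insert hj]
    simp only [smul_add, Finset.smul_sum, smul_smul, hsq, one_smul, neg_smul,
      Finset.sum_neg_distrib]
    abel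

end Dissociation

section Generic

open MeasureTheory

lemma volume_linearCombination_mem {d : ℕ} {κ : Type*} [Fintype κ] {a : κ → ℤ} (ha : a ≠ 0)
    (g : EuclideanSpace ℝ (Fin d)) {Z : Set (EuclideanSpace ℝ (Fin d))} (hZm : MeasurableSet Z)
    (hZ : volume Z = 0) :
    volume {V : κ → EuclideanSpace ℝ (Fin d) | g + ∑ i, a i • V i ∈ Z} = 0 := by
  obtain ⟨i₀, hi₀⟩ := Function.ne_iff.1 ha
  let L : (κ → EuclideanSpace ℝ (Fin d)) →ₗ[ℝ] EuclideanSpace ℝ (Fin d) :=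
    ∑ i, (a i : ℝ) • LinearMap.proj i
  have hLapply : ∀ V, L V = ∑ i, a i • V i := by
    intro V
    simp [L, LinearMap.sum_apply, Int.cast_smul_eq_zsmul]
  have hL : Function.Surjective L := by
    intro x
    refine ⟨Pi.single i₀ ((a i₀ : ℝ)⁻¹ • x), ?_⟩
    rw [hLapply, Finset.sum_eq_single i₀]
    · have : (a i₀ : ℝ) ≠ 0 := by exact_mod_cast hi₀
      rw [Pi.single_eq_same, ← Int.cast_smul_eq_zsmul ℝ, smul_inv_smul₀ this]
    · intro b _ hb
      simp [hb]
    · simp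
  have hmeas : MeasurableSet {x | g + x ∈ Z}ᶜ := (measurable_const_add g hZm).compl
  have hae := (ae_comp_linearMap_mem_iff L volume volume hL hmeas).2
    (measure_eq_zero_iff_ae_notMem.1 ((measure_preimage_add volume g Z).trans hZ))
  rw [measure_eq_zero_iff_ae_notMem]
  filter_upwards [hae] with V hV hV'
  rw [hLapply] at hV
  exact hV hV'

end Generic

section Dichotomy

open MeasureTheory Topology

variable {d : ℕ} {N : EuclideanSpace ℝ (Fin d) → ℝ}

lemma IsNorm.exists_unit_translates (hN : IsNorm N) (J : ℕ) :
    ∃ (O : Set (Fin d ⊕ Fin d → EuclideanSpace ℝ (Fin d)))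
      (u : (Fin d ⊕ Fin d → EuclideanSpace ℝ (Fin d)) → Fin J → EuclideanSpace ℝ (Fin d)),
      volume O ≠ 0 ∧ ∀ V ∈ O, ∀ (j : Fin J) (l : Fin d),
        N (u V j + V (Sum.inl l) + (j : ℕ) • V (Sum.inr l)) = 1 := by
  obtain ⟨w, hw⟩ := hN.exists_eventually_translate
  have hev : ∀ᶠ V : Fin d ⊕ Fin d → EuclideanSpace ℝ (Fin d) in 𝓝 (Sum.elim w 0),
      ∀ j : Fin J, ∃ u, ∀ l, N (u + (V (Sum.inl l) + (j : ℕ) • V (Sum.inr l))) = 1 := by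
    refine Filter.eventually_all.2 fun j => ?_
    have hcont : Continuous fun (V : Fin d ⊕ Fin d → EuclideanSpace ℝ (Fin d)) (l : Fin d) =>
        V (Sum.inl l) + (j : ℕ) • V (Sum.inr l) := by fun_prop
    refine (hcont.tendsto' (Sum.elim w 0) w ?_).eventually hw
    ext l : 1
    simp
  choose! u hu using fun (V : Fin d ⊕ Fin d → EuclideanSpace ℝ (Fin d))
    (hV : ∀ j : Fin J, ∃ u, ∀ l, N (u + (V (Sum.inl l) + (j : ℕ) • V (Sum.inr l))) = 1) =>
    Classical.skolem.1 hV
  refine ⟨_, u, (Measure.measure_pos_of_mem_nhds volume hev).ne', fun V hV j l => ?_⟩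
  rw [add_assoc]
  exact hu V hV j l

/-- The unit vectors produced by a choice of translations. -/
noncomputable def unitVectors {J : ℕ} (u : Fin J → EuclideanSpace ℝ (Fin d))
    (V : Fin d ⊕ Fin d → EuclideanSpace ℝ (Fin d)) : Finset (EuclideanSpace ℝ (Fin d)) :=
  Finset.univ.image fun p : Fin J × Fin d =>
    u p.1 + V (Sum.inl p.2) + (p.1 : ℕ) • V (Sum.inr p.2)

lemma mem_unitVectors {J : ℕ} {u : Fin J → EuclideanSpace ℝ (Fin d)}
    {V : Fin d ⊕ Fin d → EuclideanSpace ℝ (Fin d)} {x : EuclideanSpace ℝ (Fin d)} :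
    x ∈ unitVectors u V ↔
      ∃ (j : Fin J) (l : Fin d), u j + V (Sum.inl l) + (j : ℕ) • V (Sum.inr l) = x := by
  simp [unitVectors]

lemma exists_block_of_volume_eq_zero (hd : 0 < d) (hN : IsNorm N) {J M R : ℕ} (hJM : J ≤ M)
    {O : Set (Fin d ⊕ Fin d → EuclideanSpace ℝ (Fin d))}
    {u : (Fin d ⊕ Fin d → EuclideanSpace ℝ (Fin d)) → Fin J → EuclideanSpace ℝ (Fin d)}
    (hO : volume O ≠ 0) (hu : ∀ V ∈ O, ∀ (j : Fin J) (l : Fin d),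
        N (u V j + V (Sum.inl l) + (j : ℕ) • V (Sum.inr l)) = 1)
    (G : AddSubgroup (EuclideanSpace ℝ (Fin d))) [Countable G]
    (hbad : volume {V ∈ O | ∀ s : Finset (Fin J), s.card = R →
      ¬ Dissociated G M (u V) V s} = 0) :
    ∃ A : Finset (EuclideanSpace ℝ (Fin d)), A.card = 2 ^ R * (M + 1) ^ (2 * d) ∧
      (∀ x ∈ A, ∀ y ∈ A, x - y ∈ G → x = y) ∧
      2 ^ R * (M + 1 - J) ^ (2 * d) * (R * d) ≤ (unitPairs N A).card := by
  have : Nontrivial (EuclideanSpace ℝ (Fin d)) := by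
    have : Nonempty (Fin d) := ⟨⟨0, hd⟩⟩
    infer_instance
  have hdep : volume (⋃ (k : {k : Fin d ⊕ Fin d → ℤ // k ≠ 0}) (g : G),
      {V : Fin d ⊕ Fin d → EuclideanSpace ℝ (Fin d) |
        0 + ∑ i, k.1 i • V i ∈ ({(g : EuclideanSpace ℝ (Fin d))} : Set _)}) = 0 :=
    measure_iUnion_null fun k => measure_iUnion_null fun g =>
      volume_linearCombination_mem k.2 0 (measurableSet_singleton _) (measure_singleton _)
  obtain ⟨V, hVO, hV⟩ : ∃ V ∈ O, V ∉ {V ∈ O | ∀ s : Finset (Fin J), s.card = R →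
      ¬ Dissociated G M (u V) V s} ∪ _ := by
    by_contra! hcon
    exact hO (measure_mono_null hcon (measure_union_null hbad hdep))
  simp only [Set.mem_union, Set.mem_ofPred_eq, Set.mem_iUnion, Set.mem_singleton_iff, zero_add,
    not_or, not_and, not_exists, not_forall, not_not] at hV
  obtain ⟨hdis, hgen⟩ := hV
  obtain ⟨s, hs, hdis⟩ := hdis hVO
  obtain ⟨A, hA, hsep, hunit⟩ := exists_block (G := G) (α := s) (β := Fin d) (J := J) (M := M)
    (u := fun a => u V a) (V := V) (n := fun a => (a : Fin J)) hN.map_zero hN.map_neg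
    (fun a => a.1.2) hJM (fun a l => hu V hVO a l) (by
      intro δ hδ k hk hmem
      have hδ0 : δ = 0 := by
        have := hdis (fun a => if h : a ∈ s then δ ⟨a, h⟩ else 0)
          (fun a => by split_ifs; exacts [hδ _, by simp]) k hk (by
            rw [← Finset.sum_coe_sort]
            simpa using hmem)
        ext a
        simpa using this a a.2
      refine ⟨hδ0, ?_⟩
      by_contra hk0
      simp only [hδ0, Pi.zero_apply, zero_smul, Finset.sum_const_zero, zero_add] at hmem
      exact hgen ⟨k, hk0⟩ ⟨_, hmem⟩ rfl)
  simp only [Fintype.card_coe, hs, Fintype.card_fin] at hA hunit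
  exact ⟨A, hA, hsep, hunit⟩

lemma le_card_unitVectors {J r : ℕ} (hr : r ^ 2 ≤ J) {u : Fin J → EuclideanSpace ℝ (Fin d)}
    {V : Fin d ⊕ Fin d → EuclideanSpace ℝ (Fin d)} {i j : Fin d}
    (h : V (Sum.inr i) ≠ V (Sum.inr j)) : r ≤ (unitVectors u V).card := by
  refine (Nat.pow_le_pow_iff_left two_ne_zero).1 (hr.trans ?_)
  rw [sq, ← Finset.card_product]
  conv_lhs => rw [← Fintype.card_fin J, ← Finset.card_univ]
  refine Finset.card_le_card_of_injOn
    (fun a => (u a + V (Sum.inl i) + (a : ℕ) • V (Sum.inr i),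
      u a + V (Sum.inl j) + (a : ℕ) • V (Sum.inr j))) (fun a _ => ?_) (fun a _ b _ hab => ?_)
  · exact Finset.mem_product.2 ⟨mem_unitVectors.2 ⟨a, i, rfl⟩, mem_unitVectors.2 ⟨a, j, rfl⟩⟩
  · simp only [Prod.mk.injEq] at hab
    obtain ⟨h1, h2⟩ := hab
    have h3 : ((a : ℝ) - (b : ℝ)) • (V (Sum.inr i) - V (Sum.inr j)) = 0 := by
      simp only [← Nat.cast_smul_eq_nsmul ℝ] at h1 h2
      rw [← sub_eq_zero] at h1 h2
      rw [← sub_eq_zero.2 (h1.trans h2.symm)]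
      module
    rcases smul_eq_zero.1 h3 with h3 | h3
    · exact Fin.ext (by exact_mod_cast sub_eq_zero.1 h3)
    · exact absurd (sub_eq_zero.1 h3) h

lemma volume_mem_unitVectors (hd : 2 ≤ d) (hN : IsNorm N) {J : ℕ}
    {O : Set (Fin d ⊕ Fin d → EuclideanSpace ℝ (Fin d))}
    {u : (Fin d ⊕ Fin d → EuclideanSpace ℝ (Fin d)) → Fin J → EuclideanSpace ℝ (Fin d)}
    (hu : ∀ V ∈ O, ∀ (j : Fin J) (l : Fin d),
        N (u V j + V (Sum.inl l) + (j : ℕ) • V (Sum.inr l)) = 1)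
    (x : EuclideanSpace ℝ (Fin d)) : volume {V ∈ O | x ∈ unitVectors (u V) V} = 0 := by
  have hfin : Nontrivial (Fin d) := Fin.nontrivial_iff_two_le.2 hd
  choose l' hl' using fun l : Fin d => exists_ne l
  have hnull := measure_iUnion_null fun p : Fin J × Fin d =>
    volume_linearCombination_mem
      (a := fun i => (shiftCoeff (p.1 : ℕ) (l' p.2) i : ℤ) - shiftCoeff (p.1 : ℕ) p.2 i)
      (fun h => hl' p.2 (shiftCoeff_injective (p.1 : ℕ) (funext fun i => by
        have := congrFun h i
        simp only [Pi.zero_apply] at this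
        omega))) x (Z := {x | N x = 1})
      (isClosed_eq hN.continuous continuous_const).measurableSet hN.volume_sphere
  refine measure_mono_null (fun V hV => ?_) hnull
  obtain ⟨hVO, hx⟩ := hV
  obtain ⟨j, l, rfl⟩ := mem_unitVectors.1 hx
  refine Set.mem_iUnion.2 ⟨(j, l), ?_⟩
  simp only [Set.mem_ofPred_eq, sub_smul, Finset.sum_sub_distrib, sum_shiftCoeff_smul]
  rw [← hu V hVO j (l' l)]
  congr 1
  abel

lemma exists_finset_of_volume_ne_zero (hd : 2 ≤ d) (hN : IsNorm N) {J M R : ℕ}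
    {O : Set (Fin d ⊕ Fin d → EuclideanSpace ℝ (Fin d))}
    {u : (Fin d ⊕ Fin d → EuclideanSpace ℝ (Fin d)) → Fin J → EuclideanSpace ℝ (Fin d)}
    (hu : ∀ V ∈ O, ∀ (j : Fin J) (l : Fin d),
        N (u V j + V (Sum.inl l) + (j : ℕ) • V (Sum.inr l)) = 1)
    (G : AddSubgroup (EuclideanSpace ℝ (Fin d))) [Countable G]
    (hbad : volume {V ∈ O | ∀ s : Finset (Fin J), s.card = R →
      ¬ Dissociated G M (u V) V s} ≠ 0) {r : ℕ} (hr : r ^ 2 ≤ J) (m : ℕ) :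
    ∃ (s : Finset (Fin J))
      (y : Fin J ⊕ Fin m × (s ⊕ (Fin d ⊕ Fin d)) → EuclideanSpace ℝ (Fin d))
      (W : Finset (EuclideanSpace ℝ (Fin d))), s.card ≤ R ∧ (∀ w ∈ W, N w = 1) ∧
      (∀ w ∈ W, w ∈ boxSpan y (M + J)) ∧ m * r ≤ W.card := by
  obtain ⟨⟨s, g, δ, k⟩, hpat⟩ : ∃ p : Finset (Fin J) × (Fin J → G) × (Fin J → Fin J → ℤ) ×
      (Fin J → Fin d ⊕ Fin d → ℤ), volume {V ∈ O | p.1.card < R ∧ ∀ j,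
        (∀ a, |p.2.2.1 j a| ≤ 1) ∧ (∀ i, |p.2.2.2 j i| ≤ M) ∧
        u V j = p.2.1 j + (∑ a ∈ p.1, p.2.2.1 j a • u V a + ∑ i, p.2.2.2 j i • V i)} ≠ 0 := by
    by_contra! hcon
    refine hbad (measure_mono_null (fun V hV => ?_) (measure_iUnion_null hcon))
    obtain ⟨hVO, hV⟩ := hV
    obtain ⟨s, hs, hrep⟩ := exists_representation_of_not_dissociated hV
    choose g hg δ hδ k hk heq using hrep
    exact Set.mem_iUnion.2 ⟨(s, fun j => ⟨g j, hg j⟩, δ, k), hVO, hs,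
      fun j => ⟨hδ j, hk j, heq j⟩⟩
  set B := {V ∈ O | s.card < R ∧ ∀ j, (∀ a, |δ j a| ≤ 1) ∧ (∀ i, |k j i| ≤ M) ∧
    u V j = g j + (∑ a ∈ s, δ j a • u V a + ∑ i, k j i • V i)} with hB
  have hpat : volume B ≠ 0 := hpat
  have : Nontrivial (EuclideanSpace ℝ (Fin d)) := by
    have : Nonempty (Fin d) := ⟨⟨0, by omega⟩⟩
    infer_instance
  set i₀ : Fin d := ⟨0, by omega⟩
  set i₁ : Fin d := ⟨1, by omega⟩
  have hi : i₀ ≠ i₁ := by simp [i₀, i₁]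
  have hdeg : volume {V : Fin d ⊕ Fin d → EuclideanSpace ℝ (Fin d) |
      V (Sum.inr i₀) = V (Sum.inr i₁)} = 0 := by
    refine measure_mono_null (fun V hV => ?_) (volume_linearCombination_mem
      (a := Pi.single (Sum.inr i₀) 1 - Pi.single (Sum.inr i₁) 1)
      (fun h => by simpa [hi] using congrFun h (Sum.inr i₀)) 0 (measurableSet_singleton 0)
      (measure_singleton 0))
    simpa [sub_smul, Pi.single_apply, sub_eq_zero] using hV
  obtain ⟨f, hf, hdisj⟩ := exists_seq_of_forall_finset_exists
    (fun V => V ∈ B ∧ V (Sum.inr i₀) ≠ V (Sum.inr i₁))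
    (fun V V' => Disjoint (unitVectors (u V) V) (unitVectors (u V') V')) (by
      intro S _
      have hnull := measure_iUnion_null
        fun x : S.biUnion fun V => unitVectors (u V) V => volume_mem_unitVectors hd hN hu x
      obtain ⟨V, hVB, hV⟩ : ∃ V ∈ B, V ∉ _ ∪ _ := by
        by_contra! hcon
        exact hpat (measure_mono_null hcon (measure_union_null hdeg hnull))
      simp only [Set.mem_union, Set.mem_ofPred_eq, Set.mem_iUnion, not_or, not_exists,
        not_and] at hV
      refine ⟨V, ⟨hVB, hV.1⟩, fun V' hV' => Finset.disjoint_left.2 fun x hx hx' => ?_⟩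
      exact hV.2 ⟨x, Finset.mem_biUnion.2 ⟨V', hV', hx⟩⟩ hVB.1 hx')
  refine ⟨s, Sum.elim (fun j => g j) fun p => Sum.elim (fun a : s => u (f p.1) a) (f p.1) p.2,
    (Finset.univ : Finset (Fin m)).biUnion fun n => unitVectors (u (f n)) (f n),
    (hf 0).1.2.1.le, ?_, ?_, ?_⟩
  · intro w hw
    obtain ⟨n, -, hw⟩ := Finset.mem_biUnion.1 hw
    obtain ⟨j, l, rfl⟩ := mem_unitVectors.1 hw
    exact hu _ (hf n).1.1 j l
  · intro w hw
    obtain ⟨n, -, hw⟩ := Finset.mem_biUnion.1 hw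
    obtain ⟨j, l, rfl⟩ := mem_unitVectors.1 hw
    obtain ⟨hδ, hk, heq⟩ := (hf n).1.2.2 j
    have hJ := j.2
    refine mem_boxSpan.2 ⟨Sum.elim (Pi.single j 1) fun p => if p.1 = n then
      Sum.elim (fun a : s => δ j a) (fun i => k j i + shiftCoeff (j : ℕ) l i) p.2 else 0, ?_, ?_⟩
    · rintro (j' | ⟨n', a | i⟩)
      · simp only [Sum.elim_inl, Pi.single_apply]
        split_ifs <;> push_cast <;> simp <;> omega
      · simp only [Sum.elim_inr, Sum.elim_inl]
        split_ifs
        · exact (hδ a).trans (by push_cast; omega)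
        · simp; omega
      · simp only [Sum.elim_inr]
        split_ifs
        · have h1 : shiftCoeff (j : ℕ) l i ≤ J := by
            rcases i with i | i <;> simp only [shiftCoeff, Sum.elim_inl, Sum.elim_inr,
              Pi.single_apply] <;> split_ifs <;> omega
          refine (abs_add_le _ _).trans ?_
          push_cast
          refine add_le_add (hk i) ?_
          rw [Nat.abs_cast]
          exact_mod_cast h1
        · simp; omega
    · rw [Fintype.sum_sum_type, Fintype.sum_prod_type, Finset.sum_eq_single n]
      · simp only [Sum.elim_inl, Sum.elim_inr, Fintype.sum_sum_type (α₁ := s), if_true]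
        simp only [add_smul, Finset.sum_add_distrib, sum_shiftCoeff_smul]
        conv_rhs => rw [heq]
        rw [Finset.sum_coe_sort s fun a => δ j a • u (f n) a]
        simp [Pi.single_apply, ite_smul]
        abel
      · intro n' _ hn'
        simp [hn']
      · simp
  · rw [Finset.card_biUnion]
    · calc m * r = ∑ _n : Fin m, r := by simp
        _ ≤ _ := Finset.sum_le_sum fun n _ => le_card_unitVectors hr (hf n).2
    · intro n _ n' _ hne
      rcases lt_or_gt_of_ne hne with h | h
      · exact hdisj n n' h
      · exact (hdisj n' n h).symm

end Dichotomy

section Construction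

open MeasureTheory Topology Filter

variable {d : ℕ} {N : EuclideanSpace ℝ (Fin d) → ℝ}

lemma eventually_pow_lt_two_pow (k : ℕ) : ∀ᶠ q : ℕ in atTop, q ^ k < 2 ^ q := by
  have h := (isLittleO_pow_const_const_pow_of_one_lt (R := ℝ) k one_lt_two).def
    (show (0 : ℝ) < 1 / 2 by norm_num)
  filter_upwards [h] with q hq
  rw [Real.norm_of_nonneg (by positivity), Real.norm_of_nonneg (by positivity)] at hq
  have h2 : (0 : ℝ) < 2 ^ q := by positivity
  have : (q : ℝ) ^ k < 2 ^ q := by linarith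
  exact_mod_cast this

lemma mul_le_card_unitPairs_of_blocks {q : ℕ} (hq : 2 ≤ q) {P U : ℕ}
    (h : q ^ 15 * (2 ^ q * (q ^ 16 - 1 + 1 - q ^ 14) ^ (2 * d) * (q * d)) * P ≤
      U * (2 ^ q * (q ^ 16 - 1 + 1) ^ (2 * d))) :
    (1 - 2 * d / (q : ℝ)) * (d * (q : ℝ) ^ 16) * P ≤ U := by
  have hq0 : (2 : ℝ) ≤ q := by exact_mod_cast hq
  have hpos : 0 < q ^ 16 := by positivity
  rw [Nat.sub_add_cancel hpos] at h
  have hle : q ^ 14 ≤ q ^ 16 := Nat.pow_le_pow_right (by omega) (by norm_num)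
  have h' : ((q : ℝ) ^ 15 * (2 ^ q * ((q : ℝ) ^ 16 - q ^ 14) ^ (2 * d) * (q * d)) * P) ≤
      U * (2 ^ q * ((q : ℝ) ^ 16) ^ (2 * d)) := by
    have := (Nat.cast_le (α := ℝ)).2 h
    push_cast [Nat.cast_sub hle] at this
    exact this
  have hfac : ((q : ℝ) ^ 16 - q ^ 14) ^ (2 * d) =
      ((q : ℝ) ^ 16) ^ (2 * d) * (1 + -(1 / (q : ℝ) ^ 2)) ^ (2 * d) := by
    rw [← mul_pow]
    congr 1
    field_simp
    ring
  have hbern : 1 - 2 * d / (q : ℝ) ≤ (1 + -(1 / (q : ℝ) ^ 2)) ^ (2 * d) := by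
    have hsq : 1 / (q : ℝ) ^ 2 ≤ 1 / q :=
      one_div_le_one_div_of_le (by linarith) (by nlinarith)
    have hone : 1 / (q : ℝ) ≤ 1 := by
      rw [div_le_one (by linarith)]
      linarith
    refine le_trans ?_ (one_add_mul_le_pow (by linarith) (2 * d))
    push_cast
    have : 2 * (d : ℝ) * (1 / (q : ℝ) ^ 2) ≤ 2 * d * (1 / q) := by gcongr
    rw [mul_one_div] at this
    rw [mul_one_div] at this
    rw [mul_neg, mul_one_div]
    linarith
  have hc : (0 : ℝ) < 2 ^ q * ((q : ℝ) ^ 16) ^ (2 * d) := by positivity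
  refine le_of_mul_le_mul_right ?_ hc
  refine le_trans ?_ h'
  rw [hfac]
  calc _ = (1 - 2 * d / (q : ℝ)) *
        (d * (q : ℝ) ^ 16 * P * (2 ^ q * ((q : ℝ) ^ 16) ^ (2 * d))) := by ring
    _ ≤ (1 + -(1 / (q : ℝ) ^ 2)) ^ (2 * d) *
        (d * (q : ℝ) ^ 16 * P * (2 ^ q * ((q : ℝ) ^ 16) ^ (2 * d))) := by gcongr
    _ = _ := by ring

/-- For a sequence of sizes there are sets with almost the desired number of unit distances. -/
lemma IsNorm.eventually_exists_card_unitPairs (hd : 2 ≤ d) (hN : IsNorm N) :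
    ∀ᶠ q : ℕ in atTop, ∃ P : Finset (EuclideanSpace ℝ (Fin d)), P.Nonempty ∧
      P.card ≤ 2 ^ q ^ 16 * q ^ (32 * d * q ^ 15) ∧
      (1 - 2 * d / (q : ℝ)) * (d * (q : ℝ) ^ 16) * P.card ≤ (unitPairs N P).card := by
  filter_upwards [eventually_pow_lt_two_pow 66, eventually_ge_atTop (2 * d + 1)] with q hq hqd
  have hq5 : 5 ≤ q := by omega
  obtain ⟨O, u, hO, hu⟩ := hN.exists_unit_translates (q ^ 14)
  by_cases hcase : ∀ G : AddSubgroup (EuclideanSpace ℝ (Fin d)), Countable G →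
      volume {V ∈ O | ∀ s : Finset (Fin (q ^ 14)), s.card = q →
        ¬ Dissociated G (q ^ 16 - 1) (u V) V s} = 0
  · have hJM : q ^ 14 ≤ q ^ 16 - 1 :=
      Nat.le_sub_one_of_lt (Nat.pow_lt_pow_right (by omega) (by norm_num))
    obtain ⟨P, hP, hPe⟩ := exists_card_unitPairs_of_blocks hN.map_zero
      (fun G hG => exists_block_of_volume_eq_zero (by omega) hN hJM hO hu G (hcase G hG)) (q ^ 15)
    have hcard : P.card = 2 ^ q ^ 16 * q ^ (32 * d * q ^ 15) := by
      rw [hP, Nat.sub_add_cancel (Nat.one_le_pow _ _ (by omega))]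
      simp only [mul_pow, ← pow_mul]
      congr 2 <;> ring
    refine ⟨P, ?_, hcard.le, mul_le_card_unitPairs_of_blocks (by omega) hPe⟩
    rw [← Finset.card_pos, hcard]
    positivity
  · push Not at hcase
    obtain ⟨G, hG, hbad⟩ := hcase
    obtain ⟨s, y, W, hs, hW, hrep, hcard⟩ := exists_finset_of_volume_ne_zero hd hN hu G hbad
      (r := q ^ 7) (by rw [← pow_mul]) (q ^ 14)
    obtain ⟨P, hPne, hPcard, hP⟩ := exists_card_unitPairs_of_mem_boxSpan hN.map_zero y
      (T := q ^ 16) hW hrep (by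
        simp only [Fintype.card_sum, Fintype.card_prod, Fintype.card_fin, Fintype.card_coe]
        have hexp : q ^ 14 + q ^ 14 * (s.card + (d + d)) ≤ 2 * q ^ 15 := by
          calc q ^ 14 + q ^ 14 * (s.card + (d + d)) = q ^ 14 * (s.card + (2 * d + 1)) := by ring
            _ ≤ q ^ 14 * (q + q) := by gcongr
            _ = 2 * q ^ 15 := by ring
        have hbase : 2 * (q ^ 16 * (q ^ 16 - 1 + q ^ 14)) + 1 ≤ q ^ 33 := by
          have h14 : q ^ 14 ≤ q ^ 16 := Nat.pow_le_pow_right (by omega) (by norm_num)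
          have h1 : 1 ≤ q ^ 32 := Nat.one_le_pow _ _ (by omega)
          calc 2 * (q ^ 16 * (q ^ 16 - 1 + q ^ 14)) + 1
              ≤ 2 * (q ^ 16 * (q ^ 16 + q ^ 16)) + q ^ 32 := by gcongr; omega
            _ = 5 * q ^ 32 := by ring
            _ ≤ q * q ^ 32 := by gcongr
            _ = q ^ 33 := by ring
        calc _ ≤ (q ^ 33) ^ (2 * q ^ 15) :=
              (Nat.pow_le_pow_left hbase _).trans (Nat.pow_le_pow_right (by positivity) hexp)
          _ = (q ^ 66) ^ q ^ 15 := by rw [← pow_mul, ← pow_mul]; congr 1; ring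
          _ < (2 ^ q) ^ q ^ 15 := Nat.pow_lt_pow_left hq (by positivity)
          _ = 2 ^ q ^ 16 := by rw [← pow_mul]; congr 1; ring)
    refine ⟨P, hPne, hPcard.trans (Nat.le_mul_of_pos_right _ (by positivity)), ?_⟩
    have hnat : d * q ^ 16 * P.card ≤ (unitPairs N P).card := by
      have : 2 * (d * q ^ 16 * P.card) ≤ P.card * (q ^ 14 * q ^ 7) := by
        calc 2 * (d * q ^ 16 * P.card) = (2 * d) * (q ^ 16 * P.card) := by ring
          _ ≤ q ^ 5 * (q ^ 16 * P.card) := by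
            gcongr
            exact (by omega : 2 * d ≤ q).trans (Nat.le_self_pow (by norm_num) q)
          _ = _ := by ring
      have := this.trans ((Nat.mul_le_mul_left _ hcard).trans hP)
      omega
    have hreal : (d : ℝ) * (q : ℝ) ^ 16 * P.card ≤ (unitPairs N P).card := by exact_mod_cast hnat
    refine le_trans ?_ hreal
    rw [mul_assoc]
    refine mul_le_of_le_one_left (by positivity) ?_
    have : 0 ≤ 2 * (d : ℝ) / q := by positivity
    linarith

lemma exists_scale {Q n : ℕ} {f : ℕ → ℕ} (hf : ∀ q, q ≤ f q) (hQ : f Q ≤ n) :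
    ∃ q, Q ≤ q ∧ f q ≤ n ∧ n < f (q + 1) := by
  refine ⟨Nat.findGreatest (fun q => f q ≤ n) n, Nat.le_findGreatest ((hf Q).trans hQ) hQ,
    Nat.findGreatest_spec (P := fun q => f q ≤ n) ((hf Q).trans hQ) hQ, ?_⟩
  by_contra! hcon
  exact Nat.findGreatest_is_greatest (P := fun q => f q ≤ n) (Nat.lt_succ_self _)
    ((hf _).trans hcon) hcon

lemma eventually_mul_logb_le {c : ℝ} (hc : c < d) :
    ∀ᶠ q : ℕ in atTop,
      c * ((q + 1 : ℝ) ^ 16 + (32 * d * (q + 1 : ℝ) ^ 15 + 1) * Real.logb 2 (q + 1)) ≤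
        (1 - 1 / (q : ℝ)) * ((1 - 2 * d / (q : ℝ)) * (d * (q : ℝ) ^ 16)) := by
  have hinv : Tendsto (fun q : ℕ => 1 / (q : ℝ)) atTop (𝓝 0) := tendsto_one_div_atTop_nhds_zero_nat
  have hlog : Tendsto (fun q : ℕ => Real.logb 2 (q + 1) / (q : ℝ)) atTop (𝓝 0) := by
    have h1 : Tendsto (fun q : ℕ => ((q : ℝ) + 1)) atTop atTop :=
      tendsto_atTop_add_const_right _ _ tendsto_natCast_atTop_atTop
    have h2 := (Real.isLittleO_log_id_atTop.tendsto_div_nhds_zero.comp h1).mul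
      ((hinv.const_add 1).div_const (Real.log 2))
    simp only [zero_mul] at h2
    refine h2.congr' ?_
    filter_upwards [eventually_gt_atTop 0] with q hq
    have hq : (0 : ℝ) < q := by exact_mod_cast hq
    have hl : Real.log 2 ≠ 0 := (Real.log_pos one_lt_two).ne'
    simp only [Function.comp, id, Real.logb]
    field_simp
  have hleft : Tendsto (fun q : ℕ => c * ((1 + 1 / (q : ℝ)) ^ 16 +
      (32 * d * (1 + 1 / (q : ℝ)) ^ 15 + (1 / (q : ℝ)) ^ 15) * (Real.logb 2 (q + 1) / q))) atTop
      (𝓝 (c * ((1 + 0) ^ 16 + (32 * d * (1 + 0) ^ 15 + 0 ^ 15) * 0))) :=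
    ((((hinv.const_add 1).pow 16).add
      ((((((hinv.const_add 1).pow 15).const_mul _).add (hinv.pow 15))).mul hlog))).const_mul c
  have hright : Tendsto (fun q : ℕ => (1 - 1 / (q : ℝ)) * ((1 - 2 * d * (1 / (q : ℝ))) * d)) atTop
      (𝓝 ((1 - 0) * ((1 - 2 * d * 0) * d))) :=
    (hinv.const_sub 1).mul (((hinv.const_mul (2 * (d : ℝ))).const_sub 1).mul_const _)
  have hlt := hleft.eventually_lt hright (by simpa using hc)
  filter_upwards [hlt, eventually_gt_atTop 0] with q hq hq0
  have hq0 : (0 : ℝ) < q := by exact_mod_cast hq0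
  have hmul := mul_le_mul_of_nonneg_right hq.le (pow_nonneg hq0.le 16)
  refine (Eq.trans_le ?_ hmul).trans_eq ?_ <;> field_simp

lemma logb_le_of_le {n x a b : ℕ} (hn : 0 < n) (hx : 0 < x) (h : n ≤ x * (2 ^ a * x ^ b)) :
    Real.logb 2 n ≤ a + (b + 1) * Real.logb 2 x := by
  have hn' : (0 : ℝ) < n := by exact_mod_cast hn
  have hx' : (x : ℝ) ≠ 0 := by exact_mod_cast hx.ne'
  have h' : (n : ℝ) ≤ x * (2 ^ a * (x : ℝ) ^ b) := by exact_mod_cast h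
  refine (Real.logb_le_logb_of_le one_lt_two hn' h').trans_eq ?_
  rw [Real.logb_mul hx' (by simp [hx']), Real.logb_mul (by simp) (by simp [hx']),
    Real.logb_pow, Real.logb_pow, Real.logb_self_eq_one one_lt_two]
  ring

end Construction

/-- For every integer d ≥ 2, every norm ‖·‖ on ℝ^d, and every real ε > 0,
there exists N such that for every integer n ≥ N there is a set S ⊆ ℝ^d of exactly n points
spanning at least (d/2 − ε)·n·log₂ n unit distances under ‖·‖.
(The number of ordered pairs of distinct points at distance 1 is twice the number of
unordered such pairs.) -/
theorem stmt0 (d : ℕ) (hd : 2 ≤ d) (N : EuclideanSpace ℝ (Fin d) → ℝ) (hN : IsNorm N)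
    (ε : ℝ) (hε : 0 < ε) :
    ∃ N0 : ℕ, ∀ n : ℕ, N0 ≤ n →
      ∃ S : Finset (EuclideanSpace ℝ (Fin d)), S.card = n ∧
        2 * (((d : ℝ) / 2 - ε) * n * Real.logb 2 n) ≤
          (((S ×ˢ S).filter fun p => p.1 ≠ p.2 ∧ N (p.1 - p.2) = 1).card : ℝ) := by
  have hd0 : (0 : ℝ) < d := by exact_mod_cast (by omega : 0 < d)
  obtain ⟨c, hc⟩ : ∃ c, c = max ((d : ℝ) - 2 * ε) 0 := ⟨_, rfl⟩
  have hc0 : 0 ≤ c := hc ▸ le_max_right _ _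
  have hcd : c < d := hc ▸ max_lt (by linarith) hd0
  obtain ⟨Q, hQ⟩ := Filter.eventually_atTop.1 ((hN.eventually_exists_card_unitPairs hd).and
    ((eventually_mul_logb_le hcd).and (Filter.eventually_ge_atTop (2 * d))))
  set f : ℕ → ℕ := fun q => q * (2 ^ q ^ 16 * q ^ (32 * d * q ^ 15))
  have hfle : ∀ q, q ≤ f q := fun q => by
    rcases Nat.eq_zero_or_pos q with rfl | hq
    · exact Nat.zero_le _
    · exact Nat.le_mul_of_pos_right _ (by positivity)
  refine ⟨f Q, fun n hn => ?_⟩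
  obtain ⟨q, hQq, hqn, hnq⟩ := exists_scale hfle hn
  obtain ⟨⟨P, hPne, hPcard, hP⟩, hlog, hqd⟩ := hQ q hQq
  have : Infinite (EuclideanSpace ℝ (Fin d)) := by
    have : Nonempty (Fin d) := ⟨⟨0, by omega⟩⟩
    exact Module.Free.infinite ℝ _
  obtain ⟨S', hS'card, hS'⟩ := exists_card_unitPairs_copies hN.map_zero P (n / P.card)
  obtain ⟨S, hSS', hScard⟩ := Infinite.exists_superset_card_eq S' n
    (hS'card.trans_le (Nat.div_mul_le_self n _))
  refine ⟨S, hScard, ?_⟩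
  have hPn : (q : ℝ) * P.card ≤ n := by
    exact_mod_cast (Nat.mul_le_mul_left q hPcard).trans hqn
  have hq0 : (0 : ℝ) < q := by exact_mod_cast (by omega : 0 < q)
  have hPpos : 0 < P.card := hPne.card_pos
  have hfloor : (1 - 1 / (q : ℝ)) * n ≤ (n / P.card : ℕ) * (P.card : ℝ) := by
    have h1 : (n : ℝ) ≤ (n / P.card : ℕ) * (P.card : ℝ) + P.card := by
      exact_mod_cast (Nat.lt_div_mul_add hPpos).le
    have h2 : (P.card : ℝ) ≤ 1 / q * n := by
      rw [one_div, ← div_eq_inv_mul, le_div_iff₀ hq0]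
      linarith
    linarith
  have hnpos : (0 : ℝ) < n := (mul_pos hq0 (Nat.cast_pos.2 hPpos)).trans_le hPn
  have hlogn := logb_le_of_le (by exact_mod_cast hnpos) q.succ_pos hnq.le
  push_cast at hlogn
  clear hqn hnq hPcard
  have hlog0 : 0 ≤ Real.logb 2 n :=
    Real.logb_nonneg one_lt_two (by exact_mod_cast hnpos)
  have hcopies : ((n / P.card : ℕ) : ℝ) * (unitPairs N P).card ≤ (unitPairs N S).card := by
    exact_mod_cast hS'.trans (Finset.card_le_card (unitPairs_mono hN.map_zero hSS'))
  calc 2 * (((d : ℝ) / 2 - ε) * n * Real.logb 2 n)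
      = (d - 2 * ε) * (n * Real.logb 2 n) := by ring
    _ ≤ c * (n * Real.logb 2 n) := by
      gcongr
      exact hc ▸ le_max_left _ _
    _ = n * (c * Real.logb 2 n) := by ring
    _ ≤ n * (c * ((q + 1 : ℝ) ^ 16 +
        (32 * d * (q + 1 : ℝ) ^ 15 + 1) * Real.logb 2 (q + 1))) := by gcongr
    _ ≤ n * ((1 - 1 / (q : ℝ)) * ((1 - 2 * d / (q : ℝ)) * (d * (q : ℝ) ^ 16))) := by gcongr
    _ = (1 - 1 / (q : ℝ)) * n * ((1 - 2 * d / (q : ℝ)) * (d * (q : ℝ) ^ 16)) := by ring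
    _ ≤ (n / P.card : ℕ) * (P.card : ℝ) * ((1 - 2 * d / (q : ℝ)) * (d * (q : ℝ) ^ 16)) := by
      gcongr
      refine mul_nonneg ?_ (by positivity)
      rw [sub_nonneg, div_le_one hq0]
      exact_mod_cast hqd
    _ = (n / P.card : ℕ) * ((1 - 2 * d / (q : ℝ)) * (d * (q : ℝ) ^ 16) * P.card) := by ring
    _ ≤ (n / P.card : ℕ) * ((unitPairs N P).card : ℝ) := by gcongr
    _ ≤ (unitPairs N S).card := hcopies
    _ = _ := by
      rw [unitPairs]
      congr!
end

section
/- For every integer d ≥ 3, the set of unit balls B ∈ B_d such that for every integer m ≥ 1 the unit distance graph of ‖·‖_B contains a copy of K_{d,m} is comeagre in B_d (i.e., it contains a countable intersection of dense open subsets of B_d). -/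
open scoped Pointwise Classical

/-- The set of unit balls in ℝ^d: compact (and nonempty, as encoded by `NonemptyCompacts`),
convex, symmetric about the origin, containing a neighborhood of 0. The ambient type
`NonemptyCompacts (EuclideanSpace ℝ (Fin d))` carries the metric space structure given by the
Hausdorff distance induced by the Euclidean norm. -/
def UnitBalls (d : ℕ) : Set (TopologicalSpace.NonemptyCompacts (EuclideanSpace ℝ (Fin d))) :=
  {K | Convex ℝ (K : Set (EuclideanSpace ℝ (Fin d))) ∧
        (K : Set (EuclideanSpace ℝ (Fin d))) = -(K : Set (EuclideanSpace ℝ (Fin d))) ∧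
        (K : Set (EuclideanSpace ℝ (Fin d))) ∈ nhds (0 : EuclideanSpace ℝ (Fin d))}

/-- The unit distance graph of the norm `N` on ℝ^d contains a copy of `K_{a,b}`. -/
def ContainsK {d : ℕ} (N : EuclideanSpace ℝ (Fin d) → ℝ) (a b : ℕ) : Prop :=
  ∃ (u : Fin a → EuclideanSpace ℝ (Fin d)) (v : Fin b → EuclideanSpace ℝ (Fin d)),
    Function.Injective u ∧ Function.Injective v ∧
    ∀ i j, u i ≠ v j ∧ N (u i - v j) = 1

/-- A system of convex functions uniformly close to an invertible affine system taking the value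
`1` at `w₀` also takes the value `1` near `w₀`. -/
theorem exists_forall_eq_one_of_convexOn_near_affine {E : Type*} [NormedAddCommGroup E]
    [NormedSpace ℝ E] [CompleteSpace E] [Nontrivial E] {ι : Type*} [Fintype ι]
    (L : E ≃L[ℝ] (ι → ℝ)) (w₀ : E) {r : ℝ} (hr : 0 < r) :
    ∃ ε > 0, ∀ g : ι → E → ℝ, (∀ i, ConvexOn ℝ (Metric.ball w₀ (2 * r)) (g i)) →
      (∀ i, ∀ w ∈ Metric.ball w₀ (2 * r), |g i w - (L (w - w₀) i + 1)| ≤ ε) →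
      ∃ w ∈ Metric.closedBall w₀ (r / 2), ∀ i, g i w = 1 := by
  set M := L.toNonlinearRightInverse
  have hMpos : (0 : ℝ) < M.nnnorm := by
    have h : 0 < ‖(L.symm : (ι → ℝ) →L[ℝ] E)‖₊ :=
      L.subsingleton_or_nnnorm_symm_pos.resolve_left (not_subsingleton E)
    exact_mod_cast h
  refine ⟨(M.nnnorm : ℝ)⁻¹ * r / 4, by positivity, fun g hg hclose => ?_⟩
  set ε := (M.nnnorm : ℝ)⁻¹ * r / 4 with hε
  have hlip : ∀ i, LipschitzOnWith (2 * ε / r).toNNReal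
      (fun w => g i w - (L (w - w₀) i + 1)) (Metric.ball w₀ r) := by
    intro i
    have hconv : ConvexOn ℝ (Metric.ball w₀ (2 * r)) fun w => g i w - (L (w - w₀) i + 1) := by
      refine (hg i).sub ⟨convex_ball _ _, fun x _ y _ a b _ _ hab => ?_⟩
      simp only [map_sub, map_add, map_smul, Pi.sub_apply, Pi.add_apply, Pi.smul_apply,
        smul_eq_mul]
      linear_combination (1 - L w₀ i) * hab
    have h := hconv.lipschitzOnWith_of_abs_le hr (M := ε) fun w hw => hclose i w hw
    rwa [show 2 * r - r = r by ring] at h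
  have happrox : ApproximatesLinearOn (fun w i => g i w) (L : E →L[ℝ] (ι → ℝ))
      (Metric.ball w₀ r) (2 * ε / r).toNNReal := by
    intro x hx y hy
    refine (pi_norm_le_iff_of_nonneg (by positivity)).2 fun i => ?_
    have h := (hlip i).norm_sub_le hx hy
    have heq : ((fun i => g i x) - (fun i => g i y) - L (x - y)) i =
        g i x - (L (x - w₀) i + 1) - (g i y - (L (y - w₀) i + 1)) := by
      simp only [map_sub, Pi.sub_apply]
      ring
    rw [← heq] at h
    exact h
  have hsurj := happrox.surjOn_closedBall_of_nonlinearRightInverse M (ε := r / 2) (b := w₀)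
    (by positivity) (Metric.closedBall_subset_ball (by linarith))
  have hone : (fun _ => 1 : ι → ℝ) ∈ Metric.closedBall (fun i => g i w₀)
      (((M.nnnorm : ℝ)⁻¹ - (2 * ε / r).toNNReal) * (r / 2)) := by
    have hrad : ((M.nnnorm : ℝ)⁻¹ - (2 * ε / r).toNNReal) * (r / 2) = ε := by
      rw [Real.coe_toNNReal _ (by positivity), hε]
      field_simp
      ring
    rw [hrad, Metric.mem_closedBall, dist_pi_le_iff (by positivity)]
    intro i
    have h := hclose i w₀ (Metric.mem_ball_self (by linarith))
    rw [dist_comm, Real.dist_eq]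
    simpa using h
  obtain ⟨w, hw, hgw⟩ := hsurj hone
  exact ⟨w, hw, fun i => congrFun hgw i⟩

section Hausdorff

variable {E : Type*} [NormedAddCommGroup E] [NormedSpace ℝ E] {K L : Set E} {ρ θ : ℝ}

theorem subset_smul_of_forall_exists_dist_le (hK : Convex ℝ K) (hρ : 0 < ρ)
    (hball : Metric.closedBall 0 ρ ⊆ K) (hθ : 0 ≤ θ)
    (h : ∀ x ∈ L, ∃ y ∈ K, dist x y ≤ θ * ρ) : L ⊆ (1 + θ) • K := by
  intro x hx
  obtain ⟨y, hy, hxy⟩ := h x hx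
  rw [hK.add_smul zero_le_one hθ, one_smul]
  refine Set.mem_add.2 ⟨y, hy, x - y, ?_, by abel⟩
  refine Set.smul_set_mono hball ?_
  rw [smul_closedBall _ _ hρ.le, smul_zero, mem_closedBall_zero_iff, ← dist_eq_norm,
    Real.norm_of_nonneg hθ]
  exact hxy

theorem smul_subset_of_forall_exists_dist_le (hK : IsCompact K) (hρ : 0 < ρ)
    (hball : Metric.closedBall 0 ρ ⊆ K) (hL : Convex ℝ L) (hL' : IsClosed L)
    (hθ : 0 ≤ θ) (hθ1 : θ < 1) (h : ∀ x ∈ K, ∃ y ∈ L, dist x y ≤ θ * ρ) :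
    (1 - θ) • K ⊆ L := by
  rintro _ ⟨x, hx, rfl⟩
  by_contra hxL
  obtain ⟨f, s, hfL, hfx⟩ := geometric_hahn_banach_closed_point hL hL' hxL
  obtain ⟨y, hy, hmax⟩ := hK.exists_isMaxOn ⟨x, hx⟩ f.continuous.continuousOn
  obtain ⟨z, hz, hyz⟩ := h y hy
  have hyz' : y - z ∈ θ • K := by
    refine Set.smul_set_mono hball ?_
    rw [smul_closedBall _ _ hρ.le, smul_zero, mem_closedBall_zero_iff, ← dist_eq_norm,
      Real.norm_of_nonneg hθ]
    exact hyz
  obtain ⟨x', hx', hxe⟩ := hyz'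
  have h1 : f y - f z = θ * f x' := by rw [← map_sub, ← hxe]; simp
  have h2 : f x' ≤ f y := hmax hx'
  have h3 : f x ≤ f y := hmax hx
  have h4 := hfL z hz
  simp only [map_smul, smul_eq_mul] at hfx
  nlinarith

/-- Gauges of nearby convex bodies are uniformly close relative to their size. -/
theorem abs_gauge_sub_gauge_le (hK : IsCompact K) (hKc : Convex ℝ K) (hρ : 0 < ρ)
    (hball : Metric.closedBall 0 ρ ⊆ K) (hL : Convex ℝ L) (hL' : IsClosed L)
    (hL₀ : L ∈ nhds 0) (hθ : 0 ≤ θ) (hθ1 : θ ≤ 1 / 2)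
    (hKL : ∀ x ∈ K, ∃ y ∈ L, dist x y ≤ θ * ρ) (hLK : ∀ x ∈ L, ∃ y ∈ K, dist x y ≤ θ * ρ)
    (x : E) : |gauge L x - gauge K x| ≤ 2 * θ * gauge K x := by
  have hK₀ : K ∈ nhds (0 : E) := Filter.mem_of_superset (Metric.closedBall_mem_nhds 0 hρ) hball
  have hsub := smul_subset_of_forall_exists_dist_le hK hρ hball hL hL' hθ (by linarith) hKL
  have hsup := subset_smul_of_forall_exists_dist_le hKc hρ hball hθ hLK
  have h1 := gauge_mono (absorbent_nhds_zero
    ((set_smul_mem_nhds_zero_iff (show 1 - θ ≠ 0 by linarith)).2 hK₀)) hsub x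
  have h2 := gauge_mono (absorbent_nhds_zero hL₀) hsup x
  rw [gauge_smul_left_of_nonneg (by linarith), Pi.smul_apply, smul_eq_mul,
    inv_mul_eq_div] at h1 h2
  rw [le_div_iff₀ (by linarith)] at h1
  rw [div_le_iff₀ (by linarith)] at h2
  have h3 := gauge_nonneg (s := K) x
  have h4 := gauge_nonneg (s := L) x
  rw [abs_le]
  constructor <;> nlinarith

end Hausdorff

section Paraboloid

variable {F : Type*} [NormedAddCommGroup F] [InnerProductSpace ℝ F]

/-- The part of a paraboloid point depending on the direction `y`. -/
noncomputable def paraboloidShift (e₀ y : F) (δ : ℝ) : F := δ • y - (δ ^ 2 * ‖y‖ ^ 2) • e₀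

/-- The point of the paraboloid with apex `e₀` above `(δ * a) • e₁`. -/
noncomputable def paraboloidBase (e₀ e₁ : F) (a δ : ℝ) : F :=
  e₀ + (δ * a) • e₁ - (δ ^ 2 * a ^ 2) • e₀

/-- A normal vector of the paraboloid above `δ • (a • e₁ + y)`, tilted by `δ * c` along `e₁`. -/
noncomputable def paraboloidNormal (e₀ e₁ y : F) (c a δ : ℝ) : F :=
  e₀ + (2 * δ) • (a • e₁ + y) + (δ * c) • e₁

theorem inner_paraboloidNormal {e₀ e₁ y z : F} (h₀ : ‖e₀‖ = 1) (h₁ : ‖e₁‖ = 1)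
    (h₀₁ : inner ℝ e₀ e₁ = 0) (hy₀ : inner ℝ y e₀ = 0) (hy₁ : inner ℝ y e₁ = 0)
    (hz₀ : inner ℝ z e₀ = 0) (hz₁ : inner ℝ z e₁ = 0) (c a a' δ : ℝ) :
    inner ℝ (paraboloidNormal e₀ e₁ y c a δ) (paraboloidShift e₀ z δ + paraboloidBase e₀ e₁ a' δ) =
      1 + δ ^ 2 * (a ^ 2 + ‖y‖ ^ 2 + c * a) -
        δ ^ 2 * ((a' - a) ^ 2 + ‖z - y‖ ^ 2 - c * (a' - a)) := by
  have e0 : inner ℝ e₀ e₀ = 1 := by rw [real_inner_self_eq_norm_sq, h₀]; norm_num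
  have e1 : inner ℝ e₁ e₁ = 1 := by rw [real_inner_self_eq_norm_sq, h₁]; norm_num
  have h₁₀ : inner ℝ e₁ e₀ = 0 := by rw [real_inner_comm, h₀₁]
  have hz0 : inner ℝ e₀ z = 0 := by rw [real_inner_comm, hz₀]
  have hz1 : inner ℝ e₁ z = 0 := by rw [real_inner_comm, hz₁]
  have hzy : inner ℝ z y = inner ℝ y z := real_inner_comm _ _
  rw [norm_sub_sq_real]
  simp only [paraboloidNormal, paraboloidShift, paraboloidBase, inner_add_left, inner_add_right,
    inner_sub_right, inner_smul_left, inner_smul_right, e0, e1, h₀₁, h₁₀, hz0, hz1, hy₀, hy₁, hzy]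
  simp only [conj_trivial]
  ring

end Paraboloid

/-- Inside `B` there is a sumset of `d` and `m` points in which each `u i + w j` is exposed by a
functional `n i j`, with `n · j` linearly independent for every `j` and `n i j` almost bounded by
`1` on the ball of radius `‖p‖`, where `p ∈ B`. -/
theorem exists_exposed_sumset {d : ℕ} (hd : 3 ≤ d) (m : ℕ)
    {B : Set (EuclideanSpace ℝ (Fin d))} (hB : Convex ℝ B) (hB₀ : B ∈ nhds 0)
    {p : EuclideanSpace ℝ (Fin d)} (hp : p ∈ B) (hp₀ : p ≠ 0) {ε : ℝ} (hε : 0 < ε) :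
    ∃ (u : Fin d → EuclideanSpace ℝ (Fin d)) (w : Fin m → EuclideanSpace ℝ (Fin d))
      (n : Fin d → Fin m → EuclideanSpace ℝ (Fin d)),
      (∀ i j, u i + w j ∈ interior B) ∧ (∀ i j, ‖n i j‖ * ‖p‖ < 1 + ε) ∧
      (∀ i j, inner ℝ (n i j) (u i + w j) = 1) ∧
      (∀ i j k l, (i, j) ≠ (k, l) → |inner ℝ (n i j) (u k + w l)| < 1) ∧
      ∀ j v, (∀ i, inner ℝ (n i j) v = 0) → v = 0 := by
  have hR : 0 < ‖p‖ := norm_pos_iff.2 hp₀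
  obtain ⟨b, hb⟩ : ∃ b : OrthonormalBasis (Fin d) ℝ (EuclideanSpace ℝ (Fin d)),
      b ⟨0, by lia⟩ = ‖p‖⁻¹ • p := by
    obtain ⟨b, hb⟩ := Orthonormal.exists_orthonormalBasis_extension_of_card_eq (𝕜 := ℝ)
      (ι := Fin d) (E := EuclideanSpace ℝ (Fin d)) (by simp) (v := fun _ => ‖p‖⁻¹ • p)
      (s := {⟨0, by lia⟩}) (by
        rw [orthonormal_iff_ite]
        rintro ⟨i, rfl⟩ ⟨j, rfl⟩
        simp [norm_smul, hR.ne'])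
    exact ⟨b, hb _ rfl⟩
  set e₀ := b ⟨0, by lia⟩ with he₀
  set e₁ := b ⟨1, by lia⟩ with he₁
  let y : Fin d → EuclideanSpace ℝ (Fin d) := fun i =>
    if i.1 = 0 then 0 else if i.1 = 1 then -b ⟨2, by lia⟩ else b i
  let c : Fin d → ℝ := fun i => if i.1 = 1 then 1 / 2 else 0
  have hinner : ∀ i j, inner ℝ (b i) (b j) = if i = j then (1 : ℝ) else 0 :=
    orthonormal_iff_ite.1 b.orthonormal
  have hy₀ : ∀ i, inner ℝ (y i) e₀ = 0 := by
    intro i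
    simp only [y, he₀]
    split_ifs with h <;> simp [hinner, Fin.ext_iff, h]
  have hy₁ : ∀ i, inner ℝ (y i) e₁ = 0 := by
    intro i
    simp only [y, he₁]
    split_ifs <;> simp [hinner, Fin.ext_iff]
    lia
  have hyinj : Function.Injective y := by
    intro i j hij
    have h := fun k => congrArg (fun x => inner ℝ x (b k)) hij
    have hi := h i
    have hj := h j
    have h2 := h ⟨2, by lia⟩
    simp only [y] at hi hj h2
    split_ifs at hi hj h2 <;> simp [hinner, Fin.ext_iff] at hi hj h2 ⊢ <;> first | lia | grind
  have hc : ∀ i, 0 ≤ c i := fun i => by simp only [c]; split_ifs <;> norm_num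
  have hform := fun (i k : Fin d) (j l : Fin m) (δ : ℝ) =>
    inner_paraboloidNormal (e₀ := e₀) (e₁ := e₁) (by simp [he₀]) (by simp [he₁])
      (by simp [he₀, he₁, hinner]) (hy₀ i) (hy₁ i) (hy₀ k) (hy₁ k) (c i) (j : ℝ) (l : ℝ) δ
  let P : ℝ → Fin d → Fin m → EuclideanSpace ℝ (Fin d) := fun δ i j =>
    paraboloidShift e₀ (y i) δ + paraboloidBase e₀ e₁ j δ
  let N : ℝ → Fin d → Fin m → EuclideanSpace ℝ (Fin d) := fun δ i j =>
    paraboloidNormal e₀ e₁ (y i) (c i) j δ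
  have hPcont : ∀ i j, Continuous fun δ => P δ i j := fun i j => by
    simp only [P, paraboloidShift, paraboloidBase]; fun_prop
  have hNcont : ∀ i j, Continuous fun δ => N δ i j := fun i j => by
    simp only [N, paraboloidNormal]; fun_prop
  have hP0 : ∀ i j, P 0 i j = e₀ := fun i j => by simp [P, paraboloidShift, paraboloidBase]
  have hN0 : ∀ i j, N 0 i j = e₀ := fun i j => by simp [N, paraboloidNormal]
  have he₀n : ‖e₀‖ = 1 := by simp [he₀]
  set r : ℝ := ‖p‖ / (1 + ε / 2) with hr
  have hr0 : 0 < r := by positivity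
  have hre : r • e₀ ∈ interior B := by
    have h := hB.combo_interior_self_mem_interior (mem_interior_iff_mem_nhds.2 hB₀) hp
      (a := 1 - (1 + ε / 2)⁻¹) (b := (1 + ε / 2)⁻¹)
      (by rw [sub_pos]; exact inv_lt_one_of_one_lt₀ (by linarith)) (by positivity) (by ring)
    rw [smul_zero, zero_add] at h
    rwa [hb, smul_smul, hr, div_mul_eq_mul_div, mul_inv_cancel₀ hR.ne', one_div]
  have hmem : ∀ᶠ δ in nhds (0 : ℝ), ∀ i j, r • P δ i j ∈ interior B := by
    simp only [Filter.eventually_all]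
    refine fun i j => ((hPcont i j).const_smul r).continuousAt.eventually_mem ?_
    rw [Pi.smul_apply, hP0]
    exact isOpen_interior.mem_nhds hre
  have hnorm : ∀ᶠ δ in nhds (0 : ℝ), ∀ i j, ‖N δ i j‖ * (1 + ε / 2) < 1 + ε := by
    simp only [Filter.eventually_all]
    refine fun i j => ((hNcont i j).norm.mul_const _).continuousAt.eventually_lt
      continuousAt_const ?_
    rw [hN0, he₀n]
    linarith
  have hlow : ∀ᶠ δ in nhds (0 : ℝ), ∀ i j k l, -1 < inner ℝ (N δ i j) (P δ k l) := by
    simp only [Filter.eventually_all]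
    refine fun i j k l => continuousAt_const.eventually_lt
      ((hNcont i j).inner (hPcont k l)).continuousAt ?_
    rw [hN0, hP0, real_inner_self_eq_norm_sq, he₀n]
    norm_num
  obtain ⟨δ, ⟨⟨hδmem, hδnorm⟩, hδlow⟩, hδ⟩ :=
    ((((hmem.and hnorm).and hlow).filter_mono nhdsWithin_le_nhds).and
      (self_mem_nhdsWithin : Set.Ioi (0 : ℝ) ∈ nhdsWithin 0 (Set.Ioi 0))).exists
  have hself : ∀ i j, 1 ≤ inner ℝ (N δ i j) (P δ i j) := fun i j => by
    have h := hform i i j j δ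
    have := hc i
    have h2 : 0 ≤ δ ^ 2 * ((j : ℝ) ^ 2 + ‖y i‖ ^ 2 + c i * j) := by positivity
    simp only [N, P, h, sub_self, norm_zero]
    linarith
  have hlt : ∀ i j k l, (i, j) ≠ (k, l) →
      inner ℝ (N δ i j) (P δ k l) < inner ℝ (N δ i j) (P δ i j) := by
    intro i j k l hne
    simp only [N, P, hform, sub_self, norm_zero]
    have hpos : 0 < ((l : ℝ) - j) ^ 2 + ‖y k - y i‖ ^ 2 - c i * ((l : ℝ) - j) := by
      have hci : c i = 0 ∨ c i = 1 / 2 := by simp only [c]; split_ifs <;> simp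
      rcases eq_or_ne j l with rfl | hjl
      · have : 0 < ‖y k - y i‖ := by
          rw [norm_pos_iff, sub_ne_zero]
          exact fun h => hne (by rw [hyinj h])
        rw [sub_self]
        nlinarith
      · have h2 := sq_nonneg ‖y k - y i‖
        have h1 : (1 : ℝ) ≤ |(l : ℝ) - j| := by
          have : (1 : ℤ) ≤ |(l : ℤ) - j| :=
            Int.one_le_abs (sub_ne_zero.2 fun h => hjl (Fin.ext (by exact_mod_cast h.symm)))
          exact_mod_cast this
        have h3 := le_abs_self ((l : ℝ) - j)
        rw [← sq_abs ((l : ℝ) - j)]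
        rcases hci with h | h <;> rw [h] <;> nlinarith
    have := mul_pos (pow_pos hδ 2) hpos
    linarith
  have hs : ∀ i j, 0 < inner ℝ (N δ i j) (P δ i j) := fun i j => one_pos.trans_le (hself i j)
  have hscale : ∀ i j k (l : Fin m), inner ℝ ((r * inner ℝ (N δ i j) (P δ i j))⁻¹ • N δ i j)
      (r • paraboloidShift e₀ (y k) δ + r • paraboloidBase e₀ e₁ l δ) =
      inner ℝ (N δ i j) (P δ k l) / inner ℝ (N δ i j) (P δ i j) := by
    intro i j k l
    have := (hs i j).ne'
    rw [← smul_add, inner_smul_left, inner_smul_right]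
    simp only [conj_trivial]
    change _ * (r * inner ℝ (N δ i j) (P δ k l)) = _
    field_simp
  refine ⟨fun i => r • paraboloidShift e₀ (y i) δ, fun j => r • paraboloidBase e₀ e₁ j δ,
    fun i j => (r * inner ℝ (N δ i j) (P δ i j))⁻¹ • N δ i j, fun i j => ?_, fun i j => ?_,
    fun i j => ?_, fun i j k l hne => ?_, fun j v hv => ?_⟩
  · rw [← smul_add]
    exact hδmem i j
  · rw [norm_smul, norm_inv, Real.norm_of_nonneg (mul_pos hr0 (hs i j)).le]
    calc (r * inner ℝ (N δ i j) (P δ i j))⁻¹ * ‖N δ i j‖ * ‖p‖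
        = ‖N δ i j‖ * (1 + ε / 2) / inner ℝ (N δ i j) (P δ i j) := by
          rw [hr]
          have := (hs i j).ne'
          field_simp
      _ ≤ ‖N δ i j‖ * (1 + ε / 2) := div_le_self (by positivity) (hself i j)
      _ < 1 + ε := hδnorm i j
  · rw [hscale, div_self (hs i j).ne']
  · rw [hscale, abs_lt, lt_div_iff₀ (hs i j), div_lt_one (hs i j)]
    exact ⟨by linarith [hδlow i j k l, hself i j], hlt i j k l hne⟩
  · have hN : ∀ i, inner ℝ (N δ i j) v = 0 := fun i => by
      have h := hv i
      rw [inner_smul_left] at h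
      exact (mul_eq_zero.1 h).resolve_left (by simpa using ⟨(hs i j).ne', hr0.ne'⟩)
    simp only [N, paraboloidNormal, inner_add_left, inner_smul_left, conj_trivial] at hN
    have h0 := hN ⟨0, by lia⟩
    simp only [y, c] at h0
    simp at h0
    have hi : ∀ i : Fin d, 2 ≤ i.1 → inner ℝ (b i) v = 0 := fun i hi => by
      have h := hN i
      simp only [y, c, show i.1 ≠ 0 by lia, show i.1 ≠ 1 by lia, if_false] at h
      have : 2 * δ * inner ℝ (b i) v = 0 := by linarith
      simpa [hδ.ne'] using this
    have h1 := hN ⟨1, by lia⟩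
    simp only [y, c, one_ne_zero, if_false, if_true, inner_neg_left,
      hi ⟨2, by lia⟩ le_rfl] at h1
    have hv1 : inner ℝ e₁ v = 0 := by
      have : δ * inner ℝ e₁ v = 0 := by linarith
      simpa [hδ.ne'] using this
    have hv0 : inner ℝ e₀ v = 0 := by simpa [hv1] using h0
    refine b.repr.injective (PiLp.ext fun i => ?_)
    rw [b.repr_apply_apply, map_zero, PiLp.zero_apply]
    by_cases h2 : 2 ≤ i.1
    · exact hi i h2
    · obtain h | h : i.1 = 0 ∨ i.1 = 1 := by lia
      · rwa [show i = ⟨0, by lia⟩ from Fin.ext h]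
      · rwa [show i = ⟨1, by lia⟩ from Fin.ext h]

/-- Near a point exposed by exactly one of finitely many slabs, the gauge of the truncation of `B`
by the slabs is linear. -/
theorem eventually_gauge_inter_slabs_eq {E : Type*} [NormedAddCommGroup E]
    [InnerProductSpace ℝ E] {ι : Type*} [Finite ι] {B : Set E} {n : ι → E} {i : ι} {p : E}
    (hp : p ∈ interior B) (hi : inner ℝ (n i) p = 1)
    (hne : ∀ k, k ≠ i → |inner ℝ (n k) p| < 1) :
    ∀ᶠ x in nhds p, gauge (B ∩ {x | ∀ k, |inner ℝ (n k) x| ≤ 1}) x = inner ℝ (n i) x := by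
  have hc : ∀ k, Continuous fun x : E => (inner ℝ (n k) x : ℝ) := fun k => by fun_prop
  have hpos : ∀ᶠ x in nhds p, 0 < (inner ℝ (n i) x : ℝ) :=
    continuousAt_const.eventually_lt (hc i).continuousAt (by rw [hi]; exact one_pos)
  have hscale : ContinuousAt (fun x => (inner ℝ (n i) x : ℝ)⁻¹ • x) p :=
    ((hc i).continuousAt.inv₀ (by rw [hi]; exact one_ne_zero)).smul continuousAt_id
  have hscalep : (inner ℝ (n i) p : ℝ)⁻¹ • p = p := by rw [hi, inv_one, one_smul]
  have hB : ∀ᶠ x in nhds p, (inner ℝ (n i) x : ℝ)⁻¹ • x ∈ interior B :=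
    hscale.eventually_mem (by rw [hscalep]; exact isOpen_interior.mem_nhds hp)
  have hk : ∀ᶠ x in nhds p, ∀ k, k ≠ i → |inner ℝ (n k) ((inner ℝ (n i) x : ℝ)⁻¹ • x)| < 1 := by
    simp only [Filter.eventually_all]
    intro k hki
    refine ContinuousAt.eventually_lt (f := fun x => |inner ℝ (n k) ((inner ℝ (n i) x : ℝ)⁻¹ • x)|)
      (continuousAt_const.inner hscale).abs continuousAt_const ?_
    rw [hscalep]
    exact hne k hki
  filter_upwards [hpos, hB, hk] with x hx hxB hxk
  have hmem : x ∈ (inner ℝ (n i) x : ℝ) • (B ∩ {x | ∀ k, |inner ℝ (n k) x| ≤ 1}) := by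
    rw [Set.mem_smul_set_iff_inv_smul_mem₀ hx.ne']
    refine ⟨interior_subset hxB, fun k => ?_⟩
    rcases eq_or_ne k i with rfl | hki
    · simp [inner_smul_right, hx.ne']
    · exact (hxk k hki).le
  refine le_antisymm (gauge_le_of_mem hx.le hmem) (le_csInf ⟨_, hx, hmem⟩ ?_)
  rintro r ⟨hr, z, hz, rfl⟩
  simp only [inner_smul_right]
  exact mul_le_of_le_one_right hr.le ((le_abs_self _).trans (hz.2 i))

/-- A copy of `K_{d,m}` whose edges are at points where the gauge is locally linear, with linearly
independent gradients at each `w j`, survives small perturbations of the unit ball. -/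
theorem exists_forall_containsK_of_gauge_eq {d m : ℕ} [NeZero d]
    {K : Set (EuclideanSpace ℝ (Fin d))} (hK : IsCompact K) (hKc : Convex ℝ K)
    (hK₀ : K ∈ nhds 0) {u : Fin d → EuclideanSpace ℝ (Fin d)}
    {w : Fin m → EuclideanSpace ℝ (Fin d)} {n : Fin d → Fin m → EuclideanSpace ℝ (Fin d)}
    (hu : Function.Injective u) (hw : Function.Injective w)
    (hone : ∀ i j, inner ℝ (n i j) (u i + w j) = 1)
    (hgauge : ∀ i j, ∀ᶠ x in nhds (u i + w j), gauge K x = inner ℝ (n i j) x)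
    (hn : ∀ j v, (∀ i, inner ℝ (n i j) v = 0) → v = 0) :
    ∃ η > 0, ∀ L : Set (EuclideanSpace ℝ (Fin d)), Convex ℝ L → IsClosed L → L ∈ nhds 0 →
      (∀ x ∈ K, ∃ y ∈ L, dist x y ≤ η) → (∀ x ∈ L, ∃ y ∈ K, dist x y ≤ η) →
      ContainsK (gauge L) d m := by
  let φ : Fin m → EuclideanSpace ℝ (Fin d) →ₗ[ℝ] (Fin d → ℝ) := fun j =>
    LinearMap.pi fun i => (innerSL ℝ (n i j) : EuclideanSpace ℝ (Fin d) →L[ℝ] ℝ)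
  have hφ : ∀ j, Function.Injective (φ j) := fun j =>
    (injective_iff_map_eq_zero _).2 fun v hv => hn j v fun i => congrFun hv i
  let Φ : Fin m → EuclideanSpace ℝ (Fin d) ≃L[ℝ] (Fin d → ℝ) := fun j =>
    (LinearMap.linearEquivOfInjective (φ j) (hφ j) (by simp)).toContinuousLinearEquiv
  have hΦ : ∀ j v i, Φ j v i = inner ℝ (n i j) v := fun j v i => rfl
  have hnear : ∀ i j, ∃ r > 0, ∀ x ∈ Metric.ball (u i + w j) r,
      gauge K x = inner ℝ (n i j) x ∧ inner ℝ (n i j) x < 2 := by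
    intro i j
    refine Metric.eventually_nhds_iff_ball.1 ((hgauge i j).and ?_)
    refine ContinuousAt.eventually_lt (f := fun x => inner ℝ (n i j) x) (by fun_prop)
      continuousAt_const ?_
    rw [hone]
    norm_num
  choose R hR hRball using hnear
  have hrsmall : ∀ᶠ r in nhdsWithin (0 : ℝ) (Set.Ioi 0),
      (∀ i j, r < R i j / 2) ∧ ∀ j l, j ≠ l → r < dist (w j) (w l) := by
    refine Filter.Eventually.filter_mono nhdsWithin_le_nhds (Filter.Eventually.and ?_ ?_)
    · simp only [Filter.eventually_all]
      exact fun i j => gt_mem_nhds (half_pos (hR i j))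
    · simp only [Filter.eventually_all]
      exact fun j l hjl => gt_mem_nhds (dist_pos.2 (hw.ne hjl))
  obtain ⟨r, ⟨hrR, hrw⟩, hr⟩ := (hrsmall.and self_mem_nhdsWithin).exists
  choose ε hε hsolve using fun j =>
    exists_forall_eq_one_of_convexOn_near_affine (Φ j) (w j) (show 0 < r from hr)
  obtain ⟨ρ, hρ, hball⟩ := Metric.nhds_basis_closedBall.mem_iff.1 hK₀
  have hθsmall : ∀ᶠ θ in nhdsWithin (0 : ℝ) (Set.Ioi 0), θ < 1 / 2 ∧ ∀ j, θ < ε j / 4 := by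
    refine Filter.Eventually.filter_mono nhdsWithin_le_nhds
      (Filter.Eventually.and (gt_mem_nhds (by norm_num)) ?_)
    simp only [Filter.eventually_all]
    exact fun j => gt_mem_nhds (div_pos (hε j) (by norm_num))
  obtain ⟨θ, ⟨hθ1, hθε⟩, hθ⟩ := (hθsmall.and self_mem_nhdsWithin).exists
  have hθ0 : 0 < θ := hθ
  refine ⟨θ * ρ, by positivity, fun L hL hL' hL₀ hKL hLK => ?_⟩
  have hclose := abs_gauge_sub_gauge_le hK hKc hρ hball hL hL' hL₀ hθ0.le hθ1.le hKL hLK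
  have hsol : ∀ j, ∃ w' ∈ Metric.closedBall (w j) (r / 2), ∀ i, gauge L (u i + w') = 1 := by
    intro j
    refine hsolve j (fun i w' => gauge L (u i + w')) (fun i => ⟨convex_ball _ _, ?_⟩) ?_
    · intro x _ y _ a b ha hb hab
      have hcomb : u i + (a • x + b • y) = a • (u i + x) + b • (u i + y) := by
        rw [smul_add, smul_add, add_add_add_comm, ← add_smul, hab, one_smul]
      simp only [hcomb, ← gauge_smul_of_nonneg ha, ← gauge_smul_of_nonneg hb]
      exact gauge_add_le hL (absorbent_nhds_zero hL₀) _ _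
    · intro i x hx
      have hx' : u i + x ∈ Metric.ball (u i + w j) (R i j) := by
        rw [Metric.mem_ball, dist_add_left]
        have := hrR i j
        rw [Metric.mem_ball] at hx
        linarith
      obtain ⟨hg, h2⟩ := hRball i j _ hx'
      have hlin : Φ j (x - w j) i + 1 = gauge K (u i + x) := by
        rw [hΦ, hg, ← hone i j, ← inner_add_right]
        congr 1
        abel
      rw [hlin]
      refine (hclose _).trans ?_
      have := hθε j
      rw [hg]
      nlinarith
  choose w' hw' hgw using hsol
  refine ⟨u, fun j => -w' j, hu, fun j l hjl => ?_, fun i j => ?_⟩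
  · by_contra hne
    have h1 := hw' j
    have h2 := hw' l
    rw [← neg_injective hjl, Metric.mem_closedBall] at h2
    rw [Metric.mem_closedBall, dist_comm] at h1
    linarith [hrw j l hne, dist_triangle (w j) (w' j) (w l)]
  · have h := hgw j i
    refine ⟨fun heq => ?_, by simpa using h⟩
    rw [heq, neg_add_cancel, gauge_zero] at h
    exact zero_ne_one h

/-- Every unit ball is arbitrarily close to one all of whose small perturbations contain
`K_{d,m}`. -/
theorem exists_dist_lt_mem_interior_containsK {d m : ℕ} (hd : 3 ≤ d) (hm : 1 ≤ m)
    (B : ↥(UnitBalls d)) {η : ℝ} (hη : 0 < η) :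
    ∃ B' ∈ interior {B : ↥(UnitBalls d) | ContainsK (gauge
      ((B : TopologicalSpace.NonemptyCompacts (EuclideanSpace ℝ (Fin d))) :
        Set (EuclideanSpace ℝ (Fin d)))) d m}, dist B B' < η := by
  have : NeZero d := ⟨by lia⟩
  obtain ⟨B, hBc, hBs, hB₀⟩ := B
  obtain ⟨p, hp, hmax⟩ := B.isCompact.exists_isMaxOn B.nonempty continuous_norm.continuousOn
  have hmax' : ∀ x ∈ (B : Set (EuclideanSpace ℝ (Fin d))), ‖x‖ ≤ ‖p‖ := fun x hx => hmax hx
  have hp₀ : p ≠ 0 := by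
    rintro rfl
    have hsub : (B : Set (EuclideanSpace ℝ (Fin d))) ⊆ {0} := fun x hx => by
      simpa using hmax' x hx
    exact not_isOpen_singleton (0 : EuclideanSpace ℝ (Fin d))
      (isOpen_singleton_iff_nhds_eq_pure _ |>.2 (le_antisymm
        (Filter.le_pure_iff.2 (Filter.mem_of_superset hB₀ hsub)) (pure_le_nhds _)))
  have hR : 0 < ‖p‖ := norm_pos_iff.2 hp₀
  set ε := η / (2 * ‖p‖) with hε
  have hε0 : 0 < ε := by positivity
  obtain ⟨u, w, n, hmem, hnorm, hone, hlt, hn⟩ := exists_exposed_sumset hd m hBc hB₀ hp hp₀ hε0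
  let ν : Fin d × Fin m → EuclideanSpace ℝ (Fin d) := fun q => n q.1 q.2
  set S : Set (EuclideanSpace ℝ (Fin d)) := {x | ∀ q, |inner ℝ (ν q) x| ≤ 1} with hS
  have hSeq : S = ⋂ q, {x | |inner ℝ (ν q) x| ≤ 1} := by ext; simp [hS]
  have hSclosed : IsClosed S := by
    rw [hSeq]
    exact isClosed_iInter fun q => isClosed_le (by fun_prop) continuous_const
  have hSconv : Convex ℝ S := by
    rw [hSeq]
    refine convex_iInter fun q => ?_
    simp only [abs_le, Set.ofPred_and]
    exact (convex_halfSpace_ge (innerSL ℝ (ν q)).isLinear (-1)).inter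
      (convex_halfSpace_le (innerSL ℝ (ν q)).isLinear 1)
  have hS₀ : S ∈ nhds 0 := by
    simp only [hS]
    change ∀ᶠ x in nhds 0, ∀ q, |inner ℝ (ν q) x| ≤ 1
    rw [Filter.eventually_all]
    intro q
    have hlt : ∀ᶠ x in nhds (0 : EuclideanSpace ℝ (Fin d)), |inner ℝ (ν q) x| < 1 :=
      ContinuousAt.eventually_lt (f := fun x => |inner ℝ (ν q) x|) (by fun_prop)
        continuousAt_const (by simp)
    exact hlt.mono fun x hx => hx.le
  have hScale : ∀ x ∈ (B : Set (EuclideanSpace ℝ (Fin d))), (1 + ε)⁻¹ • x ∈ S := by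
    intro x hx q
    rw [inner_smul_right, abs_mul, abs_of_pos (by positivity), inv_mul_le_one₀ (by positivity)]
    calc |inner ℝ (ν q) x| ≤ ‖ν q‖ * ‖x‖ := abs_real_inner_le_norm _ _
      _ ≤ ‖ν q‖ * ‖p‖ := by gcongr; exact hmax' x hx
      _ ≤ 1 + ε := (hnorm q.1 q.2).le
  let K : TopologicalSpace.NonemptyCompacts (EuclideanSpace ℝ (Fin d)) :=
    ⟨⟨B ∩ S, B.isCompact.inter_right hSclosed⟩,
      ⟨0, mem_of_mem_nhds hB₀, mem_of_mem_nhds hS₀⟩⟩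
  have hKcoe : (K : Set (EuclideanSpace ℝ (Fin d))) = (B : Set _) ∩ S := rfl
  have hK : K ∈ UnitBalls d := by
    refine ⟨hBc.inter hSconv, ?_, Filter.inter_mem hB₀ hS₀⟩
    rw [hKcoe, Set.inter_neg, ← hBs]
    congr 1
    ext x
    simp [hS]
  have hdist : dist B K < η := by
    rw [Metric.NonemptyCompacts.dist_eq]
    refine (Metric.hausdorffDist_le_of_mem_dist (r := η / 2) (by positivity) ?_ ?_).trans_lt
      (half_lt_self hη)
    · intro x hx
      refine ⟨(1 + ε)⁻¹ • x, ⟨hBc.smul_mem_of_zero_mem (mem_of_mem_nhds hB₀) hx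
        ⟨by positivity, inv_le_one_of_one_le₀ (by linarith)⟩, hScale x hx⟩, ?_⟩
      have hsub : x - (1 + ε)⁻¹ • x = (ε / (1 + ε)) • x := by
        nth_rewrite 1 [← one_smul ℝ x]
        rw [← sub_smul]
        congr 1
        field_simp
        ring
      rw [dist_eq_norm, hsub, norm_smul, Real.norm_of_nonneg (by positivity)]
      calc ε / (1 + ε) * ‖x‖ ≤ ε * ‖p‖ := by
            gcongr
            · exact div_le_self hε0.le (by linarith)
            · exact hmax' x hx
        _ = η / 2 := by rw [hε]; field_simp
    · exact fun x hx => ⟨x, hx.1, by rw [dist_self]; positivity⟩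
  have hu : Function.Injective u := by
    intro i k hik
    by_contra hne
    have h := hlt i ⟨0, hm⟩ k ⟨0, hm⟩ (by simpa using hne)
    rw [← hik, hone] at h
    norm_num at h
  have hw : Function.Injective w := by
    intro j l hjl
    by_contra hne
    have h := hlt 0 j 0 l (by simpa using hne)
    rw [← hjl, hone] at h
    norm_num at h
  obtain ⟨κ, hκ, hstable⟩ := exists_forall_containsK_of_gauge_eq K.isCompact hK.1 hK.2.2 hu hw hone
    (fun i j => eventually_gauge_inter_slabs_eq (n := ν) (i := (i, j)) (hmem i j) (hone i j)
      fun q hq => hlt q.1 q.2 i j hq) hn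
  refine ⟨⟨K, hK⟩, ?_, hdist⟩
  rw [mem_interior_iff_mem_nhds, Metric.mem_nhds_iff]
  refine ⟨κ, hκ, ?_⟩
  rintro ⟨L, hLc, _, hL₀⟩ hLK
  rw [Metric.mem_ball, Subtype.dist_eq, Metric.NonemptyCompacts.dist_eq] at hLK
  have hfin : Metric.hausdorffEDist (L : Set (EuclideanSpace ℝ (Fin d))) K ≠ ⊤ :=
    Metric.hausdorffEDist_ne_top_of_nonempty_of_bounded L.nonempty K.nonempty
      L.isCompact.isBounded K.isCompact.isBounded
  refine hstable L hLc L.isCompact.isClosed hL₀ (fun x hx => ?_) fun x hx => ?_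
  · obtain ⟨y, hy, hxy⟩ := Metric.exists_dist_lt_of_hausdorffDist_lt' hx hLK hfin
    exact ⟨y, hy, by rw [dist_comm]; exact hxy.le⟩
  · obtain ⟨y, hy, hxy⟩ := Metric.exists_dist_lt_of_hausdorffDist_lt hx hLK hfin
    exact ⟨y, hy, hxy.le⟩

/-- For every integer d ≥ 3, the set of unit balls B ∈ B_d such that for every
integer m ≥ 1 the unit distance graph of ‖·‖_B contains a copy of K_{d,m} is comeagre in B_d.
(Here `‖x‖_B` is the Minkowski gauge of `B`, and `residual` is the filter of comeagre sets:
a set belongs to it iff it contains a countable intersection of dense open sets.) -/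
theorem stmt1 (d : ℕ) (hd : 3 ≤ d) :
    {B : ↥(UnitBalls d) |
        ∀ m : ℕ, 1 ≤ m →
          ContainsK (gauge ((B : TopologicalSpace.NonemptyCompacts (EuclideanSpace ℝ (Fin d))) :
            Set (EuclideanSpace ℝ (Fin d)))) d m} ∈ residual ↥(UnitBalls d) := by
  change ∀ᶠ B in residual ↥(UnitBalls d), ∀ m : ℕ, 1 ≤ m → _
  refine eventually_countable_forall.2 fun m => ?_
  by_cases hm : 1 ≤ m
  · have hdense : Dense (interior {B : ↥(UnitBalls d) | ContainsK (gauge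
        ((B : TopologicalSpace.NonemptyCompacts (EuclideanSpace ℝ (Fin d))) :
          Set (EuclideanSpace ℝ (Fin d)))) d m}) := by
      refine Metric.dense_iff.2 fun B η hη => ?_
      obtain ⟨B', hB', hdist⟩ := exists_dist_lt_mem_interior_containsK hd hm B hη
      exact ⟨B', by rwa [Metric.mem_ball, dist_comm], hB'⟩
    filter_upwards [residual_of_dense_open isOpen_interior hdense] with B hB _
    have hmem := interior_subset hB
    exact hmem
  · exact Filter.Eventually.of_forall fun B h => absurd h hm
end

section
/- For every integer d ≥ 3 and every integer m ≥ 1, there exists a subset A_m ⊆ B_d that is open and dense in the Hausdorff metric such that for every unit ball B ∈ A_m, the unit distance graph of ‖·‖_B contains a copy of K_{d,m}. -/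
open scoped Pointwise Classical

open Metric Filter Topology TopologicalSpace

section Gauge

variable {E : Type*} [NormedAddCommGroup E]

theorem gauge_le_mul_gauge [NormedSpace ℝ E] {S T : Set E} {c : ℝ} (hc : 0 ≤ c)
    (hS : Absorbent ℝ S) (h : ∀ y ∈ S, gauge T y ≤ c) (x : E) :
    gauge T x ≤ c * gauge S x := by
  refine le_of_forall_pos_le_add fun ε hε => ?_
  obtain ⟨b, hb, hb', y, hy, rfl⟩ := exists_lt_of_gauge_lt hS
    (show gauge S x < gauge S x + ε / (c + 1) by
      have : 0 < ε / (c + 1) := by positivity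
      linarith)
  simp only at hb' ⊢
  have hT : gauge T (b • y) = b * gauge T y := gauge_smul_of_nonneg hb.le y
  have h1 : gauge T (b • y) ≤ c * b := by
    rw [hT, mul_comm]
    exact mul_le_mul_of_nonneg_right (h y hy) hb.le
  have h2 : c * (ε / (c + 1)) ≤ ε := by
    rw [mul_div_assoc', div_le_iff₀ (by positivity)]
    nlinarith
  nlinarith [mul_le_mul_of_nonneg_left hb'.le hc]

theorem gauge_le_of_forall_exists_dist_lt [NormedSpace ℝ E] {S T : Set E} {ρ δ : ℝ} (hρ : 0 < ρ)
    (hδ : 0 ≤ δ) (hT : Convex ℝ T) (hTρ : ball 0 ρ ⊆ T) (hS : Absorbent ℝ S)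
    (h : ∀ x ∈ S, ∃ y ∈ T, dist x y < δ) (x : E) :
    gauge T x ≤ (1 + δ / ρ) * gauge S x := by
  refine gauge_le_mul_gauge (by positivity) hS (fun y hy => ?_) x
  obtain ⟨z, hz, hyz⟩ := h y hy
  have hTa : Absorbent ℝ T := absorbent_nhds_zero (mem_of_superset (ball_mem_nhds _ hρ) hTρ)
  calc gauge T y = gauge T (z + (y - z)) := by rw [add_sub_cancel]
    _ ≤ gauge T z + gauge T (y - z) := gauge_add_le hT hTa _ _
    _ ≤ 1 + δ / ρ := by
      refine add_le_add (gauge_le_one_of_mem hz) ?_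
      rw [le_div_iff₀' hρ]
      exact (mul_gauge_le_norm hTρ).trans (by rw [← dist_eq_norm]; exact hyz.le)

theorem ball_subset_of_forall_exists_dist_lt [InnerProductSpace ℝ E] [CompleteSpace E]
    {S : Set E} {ρ : ℝ}
    (hρ : 0 < ρ) (hS : Convex ℝ S) (hSc : IsClosed S)
    (h : ∀ x ∈ ball (0 : E) ρ, ∃ y ∈ S, dist x y < ρ / 2) : ball 0 (ρ / 2) ⊆ S := by
  intro x hx
  by_contra hxS
  obtain ⟨f, u, hf, hu⟩ := geometric_hahn_banach_closed_point hS hSc hxS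
  set w := (InnerProductSpace.toDual ℝ E).symm f with hw
  have hfw : ∀ y, f y = inner ℝ w y := fun y => by
    rw [hw, InnerProductSpace.toDual_symm_apply]
  have hw0 : w ≠ 0 := by
    intro hw0
    obtain ⟨s, hs, -⟩ := h 0 (mem_ball_self hρ)
    have := hf s hs
    simp only [hfw, hw0, inner_zero_left] at this hu
    linarith
  have hwn : 0 < ‖w‖ := norm_pos_iff.2 hw0
  obtain ⟨s, hs, hd⟩ := h (x + (ρ / 2 / ‖w‖) • w) (by
    rw [mem_ball_zero_iff] at hx ⊢
    refine (norm_add_le _ _).trans_lt ?_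
    rw [norm_smul, Real.norm_of_nonneg (by positivity), div_mul_cancel₀ _ hwn.ne']
    linarith)
  have h1 := hf s hs
  have h2 : f (x + (ρ / 2 / ‖w‖) • w - s) ≤ ‖w‖ * (ρ / 2) := by
    rw [hfw]
    refine (real_inner_le_norm _ _).trans (mul_le_mul_of_nonneg_left ?_ hwn.le)
    rw [← dist_eq_norm]
    exact hd.le
  have h3 : f w = ‖w‖ * ‖w‖ := by rw [hfw, real_inner_self_eq_norm_mul_norm]
  rw [map_sub, map_add, map_smul, h3, smul_eq_mul] at h2
  have h4 : ρ / 2 / ‖w‖ * (‖w‖ * ‖w‖) = ‖w‖ * (ρ / 2) := by field_simp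
  linarith

theorem convexOn_gauge [NormedSpace ℝ E] {S : Set E} (hS : Convex ℝ S) (hSa : Absorbent ℝ S) :
    ConvexOn ℝ Set.univ (gauge S) := by
  refine ⟨convex_univ, fun x _ y _ a b ha hb _ => ?_⟩
  refine (gauge_add_le hS hSa _ _).trans_eq ?_
  rw [gauge_smul_of_nonneg ha, gauge_smul_of_nonneg hb]

theorem gauge_eq_of_le_of_mem [NormedSpace ℝ E] {S : Set E} (hS : Absorbent ℝ S)
    {f : E →L[ℝ] ℝ} (hf : ∀ y ∈ S, f y ≤ 1) {x : E} (hx : 0 < f x) (hxS : (f x)⁻¹ • x ∈ S) :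
    gauge S x = f x := by
  refine le_antisymm (gauge_le_of_mem hx.le ((Set.mem_smul_set_iff_inv_smul_mem₀ hx.ne' _ _).2 hxS))
    (le_of_forall_gt_imp_ge_of_dense fun a ha => ?_)
  obtain ⟨b, hb, hb', y, hy, rfl⟩ := exists_lt_of_gauge_lt hS ha
  have := hf y hy
  simp only [map_smul, smul_eq_mul]
  nlinarith

/-- A map whose components are convex functions uniformly close to the components of an invertible
affine map `L + c` on a ball attains nearby values. -/
theorem exists_eq_of_convexOn_of_abs_sub_le [NormedSpace ℝ E] [CompleteSpace E] {ι : Type*}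
    [Fintype ι] [Nonempty ι]
    (L : E ≃L[ℝ] (ι → ℝ)) (c : ι → ℝ) (v : E) {r : ℝ} (hr : 0 < r) :
    ∃ κ > 0, ∀ F : ι → E → ℝ, (∀ i, ConvexOn ℝ Set.univ (F i)) →
      (∀ x ∈ ball v r, ∀ i, |F i x - (L x i + c i)| ≤ κ) →
      ∃ x ∈ ball v r, ∀ i, F i x = L v i + c i := by
  set K : ℝ := L.toNonlinearRightInverse.nnnorm + 1 with hK
  have hn : (0 : ℝ) < L.toNonlinearRightInverse.nnnorm := by
    have : Nontrivial E := L.symm.injective.nontrivial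
    exact L.norm_symm_pos
  have hK0 : 0 < K := by linarith
  refine ⟨r / (8 * K), by positivity, fun F hF hclose => ?_⟩
  set κ := r / (8 * K) with hκ
  have hκ0 : 0 < κ := by positivity
  let G : E → ι → ℝ := fun x i => F i x
  have hlip : ∀ i, LipschitzOnWith (2 * κ / (r / 2)).toNNReal
      (fun x => F i x - (L x i + c i)) (ball v (r - r / 2)) := by
    intro i
    refine ConvexOn.lipschitzOnWith_of_abs_le ?_ (by positivity) (fun a ha => hclose a ha i)
    refine ((hF i).subset (Set.subset_univ _) (convex_ball _ _)).sub ?_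
    refine ⟨convex_ball _ _, fun x _ y _ a b _ _ hab => le_of_eq ?_⟩
    have : c i = (a + b) * c i := by rw [hab, one_mul]
    simp only [map_add, map_smul, Pi.add_apply, Pi.smul_apply, smul_eq_mul]
    linear_combination -this
  have happ : ApproximatesLinearOn G (L : E →L[ℝ] (ι → ℝ)) (ball v (r - r / 2))
      (2 * κ / (r / 2)).toNNReal := by
    intro x hx y hy
    refine (pi_norm_le_iff_of_nonneg (by positivity)).2 fun i => ?_
    have := (hlip i).dist_le_mul x hx y hy
    rw [dist_eq_norm, dist_eq_norm] at this
    refine le_of_eq_of_le (congrArg norm ?_) this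
    simp only [G, Pi.sub_apply, map_sub, ContinuousLinearEquiv.coe_coe]
    ring
  have hsub : closedBall v (r / 4) ⊆ ball v (r - r / 2) :=
    closedBall_subset_ball (by linarith)
  have hsurj := happ.surjOn_closedBall_of_nonlinearRightInverse L.toNonlinearRightInverse
    (by positivity : 0 ≤ r / 4) hsub
  have hmem : (fun i => L v i + c i) ∈ closedBall (G v)
      (((L.toNonlinearRightInverse.nnnorm : ℝ)⁻¹ - (2 * κ / (r / 2)).toNNReal) * (r / 4)) := by
    have h1 : K⁻¹ ≤ (L.toNonlinearRightInverse.nnnorm : ℝ)⁻¹ :=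
      inv_anti₀ hn (by linarith)
    have h2 : 2 * κ / (r / 2) = K⁻¹ / 2 := by
      rw [hκ]
      field_simp
      norm_num
    have h3 : κ = K⁻¹ / 2 * (r / 4) := by
      rw [hκ]
      field_simp
      norm_num
    rw [Real.coe_toNNReal _ (by positivity), h2, mem_closedBall, dist_comm]
    refine (dist_pi_le_iff ?_).2 fun i => ?_
    · refine mul_nonneg ?_ (by positivity)
      have : 0 < K⁻¹ := by positivity
      linarith
    · refine (hclose v (mem_ball_self hr) i).trans ?_
      rw [h3]
      exact mul_le_mul_of_nonneg_right (by linarith) (by positivity)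
  obtain ⟨x, hx, hxe⟩ := hsurj hmem
  exact ⟨x, closedBall_subset_ball (by linarith) hx, fun i => congrFun hxe i⟩

end Gauge

section UnitBalls

variable {d : ℕ}

theorem absorbent_of_mem_unitBalls (B : UnitBalls d) :
    Absorbent ℝ ((B : NonemptyCompacts (EuclideanSpace ℝ (Fin d))) :
      Set (EuclideanSpace ℝ (Fin d))) :=
  absorbent_nhds_zero B.2.2.2

theorem eventually_abs_gauge_sub_le (B₁ : UnitBalls d) {κ : ℝ} (hκ : 0 < κ) (C : ℝ) :
    ∀ᶠ B : UnitBalls d in 𝓝 B₁, ∀ x : EuclideanSpace ℝ (Fin d), ‖x‖ ≤ C →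
      |gauge (B : NonemptyCompacts (EuclideanSpace ℝ (Fin d))).carrier x
        - gauge (B₁ : NonemptyCompacts (EuclideanSpace ℝ (Fin d))).carrier x| ≤ κ := by
  obtain ⟨ρ, hρ, hρB⟩ := Metric.mem_nhds_iff.1 B₁.2.2.2
  have hM : 0 < |C| + 1 := by positivity
  set δ := min (ρ / 2) (κ * ρ ^ 2 / (2 * (|C| + 1))) with hδ
  have hδ0 : 0 < δ := by positivity
  filter_upwards [Metric.ball_mem_nhds B₁ hδ0] with B hB x hx
  rw [mem_ball, Subtype.dist_eq, NonemptyCompacts.dist_eq] at hB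
  have hfin := Metric.hausdorffEDist_ne_top_of_nonempty_of_bounded
    B.1.nonempty B₁.1.nonempty B.1.isCompact.isBounded B₁.1.isCompact.isBounded
  have h1 : ∀ x ∈ B.1.carrier, ∃ y ∈ B₁.1.carrier, dist x y < δ := fun x hx =>
    exists_dist_lt_of_hausdorffDist_lt hx hB hfin
  have h2 : ∀ x ∈ B₁.1.carrier, ∃ y ∈ B.1.carrier, dist x y < δ := fun x hx => by
    obtain ⟨y, hy, h⟩ := exists_dist_lt_of_hausdorffDist_lt' hx hB hfin
    exact ⟨y, hy, by rwa [dist_comm]⟩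
  have hball : ball 0 (ρ / 2) ⊆ B.1.carrier :=
    ball_subset_of_forall_exists_dist_lt hρ B.2.1 B.1.isCompact.isClosed fun x hx => by
      obtain ⟨y, hy, h⟩ := h2 x (hρB hx)
      exact ⟨y, hy, h.trans_le (min_le_left _ _)⟩
  have g1 := gauge_le_of_forall_exists_dist_lt hρ hδ0.le B₁.2.1 hρB
    (absorbent_of_mem_unitBalls B) h1 x
  have g2 := gauge_le_of_forall_exists_dist_lt (half_pos hρ) hδ0.le B.2.1 hball
    (absorbent_of_mem_unitBalls B₁) h2 x
  have g3 : gauge B₁.1.carrier x ≤ |C| / ρ := by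
    rw [le_div_iff₀' hρ]
    exact (mul_gauge_le_norm hρB).trans (hx.trans (le_abs_self _))
  have g4 : gauge B.1.carrier x ≤ 2 * (|C| / ρ) := by
    rw [← mul_div_assoc, le_div_iff₀' hρ]
    have := (mul_gauge_le_norm (x := x) hball).trans (hx.trans (le_abs_self _))
    linarith
  have hδ2 : δ / ρ * (2 * (|C| / ρ)) ≤ κ := by
    have : δ * (2 * (|C| + 1)) ≤ κ * ρ ^ 2 :=
      (le_div_iff₀ (by positivity)).1 (min_le_right _ _)
    have h' : δ / ρ * (2 * (|C| / ρ)) = δ * (2 * |C|) / ρ ^ 2 := by field_simp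
    rw [h', div_le_iff₀ (by positivity)]
    nlinarith
  have hδρ : 0 ≤ δ / ρ := by positivity
  have e1 : δ / (ρ / 2) = 2 * (δ / ρ) := by field_simp
  rw [e1] at g2
  change gauge B₁.1.carrier x ≤ (1 + δ / ρ) * gauge B.1.carrier x at g1
  change gauge B.1.carrier x ≤ (1 + 2 * (δ / ρ)) * gauge B₁.1.carrier x at g2
  have k1 := mul_le_mul_of_nonneg_left g3 hδρ
  have k2 := mul_le_mul_of_nonneg_left g4 hδρ
  rw [abs_sub_le_iff]
  constructor <;> nlinarith

theorem eventually_exists_gauge_eq_one [NeZero d] (B₁ : UnitBalls d)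
    (u : Fin d → EuclideanSpace ℝ (Fin d))
    (v : EuclideanSpace ℝ (Fin d)) (L : EuclideanSpace ℝ (Fin d) ≃L[ℝ] (Fin d → ℝ))
    (c : Fin d → ℝ)
    (hL : ∀ᶠ x in 𝓝 v, ∀ i,
      gauge (B₁ : NonemptyCompacts (EuclideanSpace ℝ (Fin d))).carrier (x - u i) = L x i + c i)
    (hv : ∀ i, L v i + c i = 1) {r : ℝ} (hr : 0 < r) :
    ∀ᶠ B : UnitBalls d in 𝓝 B₁, ∃ x ∈ ball v r, ∀ i,
      gauge (B : NonemptyCompacts (EuclideanSpace ℝ (Fin d))).carrier (x - u i) = 1 := by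
  obtain ⟨r', hr', hball⟩ := Metric.eventually_nhds_iff_ball.1 hL
  obtain ⟨κ, hκ, hF⟩ := exists_eq_of_convexOn_of_abs_sub_le L c v (lt_min hr hr')
  obtain ⟨C, hC⟩ : ∃ C, ∀ i, ‖v‖ + r + ‖u i‖ ≤ C := by
    obtain ⟨C, hC⟩ := (Set.finite_range fun i => ‖v‖ + r + ‖u i‖).bddAbove
    exact ⟨C, fun i => hC ⟨i, rfl⟩⟩
  filter_upwards [eventually_abs_gauge_sub_le B₁ hκ C] with B hB
  obtain ⟨x, hx, hxe⟩ := hF (fun i x => gauge B.1.carrier (x - u i))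
    (fun i => by
      have := (convexOn_gauge B.2.1 (absorbent_of_mem_unitBalls B)).translate_left (- u i)
      simpa [Function.comp_def, sub_eq_add_neg] using this)
    (fun x hx i => by
      rw [← hball x (ball_subset_ball (min_le_right _ _) hx) i]
      refine hB _ ((norm_sub_le _ _).trans (le_trans ?_ (hC i)))
      have h1 : ‖x - v‖ < r := by
        rw [← dist_eq_norm]
        exact lt_of_lt_of_le hx (min_le_left _ _)
      have h2 : ‖x‖ ≤ ‖v‖ + ‖x - v‖ := norm_le_norm_add_norm_sub' x v
      linarith)
  exact ⟨x, ball_subset_ball (min_le_left _ _) hx, fun i => (hxe i).trans (hv i)⟩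

end UnitBalls

section Construction

variable {n : ℕ}

/-- The functional `x ↦ x 0 + τ * (2 * i * x 1 + 2 * j * x 2 + x i / 2)`, where the last summand is
present only if `2 ≤ i`. -/
noncomputable def tilt (τ : ℝ) (i : Fin (n + 3)) (j : ℕ) :
    EuclideanSpace ℝ (Fin (n + 3)) →L[ℝ] ℝ :=
  EuclideanSpace.proj 0 + τ • ((2 * (i : ℕ) : ℝ) • EuclideanSpace.proj 1
    + (2 * j : ℝ) • EuclideanSpace.proj 2
    + (if 2 ≤ (i : ℕ) then (1 / 2 : ℝ) else 0) • EuclideanSpace.proj i)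

/-- The centres of the `n + 3` unit spheres. -/
noncomputable def center (τ : ℝ) (i : Fin (n + 3)) : EuclideanSpace ℝ (Fin (n + 3)) :=
  EuclideanSpace.single 0 (τ ^ 2 * (i : ℕ) ^ 2) - EuclideanSpace.single 1 (τ * (i : ℕ))

/-- The common points of the unit spheres. -/
noncomputable def commonPoint (z : EuclideanSpace ℝ (Fin (n + 3))) (τ : ℝ) (j : ℕ) :
    EuclideanSpace ℝ (Fin (n + 3)) :=
  z + EuclideanSpace.single 2 (τ * j) - EuclideanSpace.single 0 (τ ^ 2 * j ^ 2)

theorem tilt_apply (τ : ℝ) (i : Fin (n + 3)) (j : ℕ) (x : EuclideanSpace ℝ (Fin (n + 3))) :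
    tilt τ i j x = x 0 + τ * (2 * (i : ℕ) * x 1 + 2 * j * x 2
      + (if 2 ≤ (i : ℕ) then (1 / 2 : ℝ) else 0) * x i) := by
  simp only [tilt, add_apply, smul_apply, smul_eq_mul, EuclideanSpace.coe_proj]

theorem abs_tilt_le {τ : ℝ} (hτ : 0 ≤ τ) (i : Fin (n + 3)) (j : ℕ)
    (x : EuclideanSpace ℝ (Fin (n + 3))) :
    |tilt τ i j x| ≤ |x 0| + τ * ((2 * (i : ℕ) + 2 * j + 1) * ‖x‖) := by
  have hx : ∀ k, |x k| ≤ ‖x‖ := fun k => PiLp.norm_apply_le x k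
  rw [tilt_apply]
  refine (abs_add_le _ _).trans (add_le_add le_rfl ?_)
  rw [abs_mul, abs_of_nonneg hτ]
  refine mul_le_mul_of_nonneg_left ?_ hτ
  refine (abs_add_three _ _ _).trans ?_
  rw [add_mul, add_mul, abs_mul, abs_mul _ (x 2), abs_mul _ (x i), abs_of_nonneg (a := 2 * ((i : ℕ) : ℝ))
    (by positivity), abs_of_nonneg (a := 2 * (j : ℝ)) (by positivity)]
  gcongr
  · exact hx 1
  · exact hx 2
  · split_ifs <;> norm_num
  · exact hx i

theorem tilt_commonPoint_sub_center (z : EuclideanSpace ℝ (Fin (n + 3))) (τ : ℝ)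
    (i k : Fin (n + 3)) (j l : ℕ) :
    tilt τ i j (commonPoint z τ l - center τ k) = tilt τ i j z + τ ^ 2 *
      (2 * (i : ℕ) * (k : ℕ) + 2 * j * l + (if (i : ℕ) = 2 then (1 / 2 : ℝ) else 0) * l
        - (k : ℕ) ^ 2 - l ^ 2) := by
  have h12 : (1 : Fin (n + 3)) ≠ 2 := by rw [Fin.ne_iff_vne, Fin.val_two]; simp
  have h01 : (0 : Fin (n + 3)) ≠ 1 := by simp
  have h02 : (0 : Fin (n + 3)) ≠ 2 := by rw [Fin.ne_iff_vne, Fin.val_two]; simp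
  have hi2 : i = 2 ↔ (i : ℕ) = 2 := by rw [Fin.ext_iff, Fin.val_two]
  have hi : 2 ≤ (i : ℕ) → i ≠ 0 ∧ i ≠ 1 := by
    intro h
    constructor <;> rintro rfl <;> simp at h
  rw [tilt_apply, tilt_apply]
  by_cases h : 2 ≤ (i : ℕ)
  · obtain ⟨hi0, hi1⟩ := hi h
    by_cases h2 : (i : ℕ) = 2
    · obtain rfl := hi2.2 h2
      rw [if_pos h, if_pos h2]
      simp [commonPoint, center, h12, h01, h02, h12.symm, h01.symm, h02.symm]
      ring
    · have h2' : i ≠ 2 := fun e => h2 (hi2.1 e)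
      simp [commonPoint, center, h12, h01, h02, h12.symm, h01.symm, h02.symm, h, h2, h2', hi0, hi1]
      ring
  · have h2 : (i : ℕ) ≠ 2 := by omega
    simp [commonPoint, center, h12, h01, h02, h12.symm, h01.symm, h02.symm, h, h2]
    ring

theorem tilt_lt_tilt (z : EuclideanSpace ℝ (Fin (n + 3))) {τ : ℝ} (hτ : 0 < τ)
    {i k : Fin (n + 3)} {j l : ℕ} (h : (k, l) ≠ (i, j)) :
    tilt τ i j (commonPoint z τ l - center τ k) < tilt τ i j (commonPoint z τ j - center τ i) := by
  rw [tilt_commonPoint_sub_center, tilt_commonPoint_sub_center]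
  refine add_lt_add_of_le_of_lt le_rfl (mul_lt_mul_of_pos_left ?_ (by positivity))
  set θ : ℝ := if (i : ℕ) = 2 then (1 / 2 : ℝ) else 0 with hθ
  have hθ0 : 0 ≤ θ := by rw [hθ]; split_ifs <;> norm_num
  have hθ1 : θ ≤ 1 / 2 := by rw [hθ]; split_ifs <;> norm_num
  suffices 0 < (((k : ℕ) : ℝ) - (i : ℕ)) ^ 2 + (((l : ℝ) - j) ^ 2 - θ * (l - j)) by nlinarith
  rcases eq_or_ne l j with rfl | hl
  · have hk : ((k : ℕ) : ℝ) - (i : ℕ) ≠ 0 := by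
      rw [sub_ne_zero]
      intro e
      exact h (by rw [Fin.ext (Nat.cast_injective e)])
    have := sq_pos_of_ne_zero hk
    simpa using this
  · refine add_pos_of_nonneg_of_pos (sq_nonneg _) ?_
    rcases lt_or_gt_of_ne hl with hl | hl
    · have : (l : ℝ) + 1 ≤ j := by exact_mod_cast hl
      nlinarith
    · have : (j : ℝ) + 1 ≤ l := by exact_mod_cast hl
      nlinarith

theorem exists_equiv_tilt {τ : ℝ} (hτ : 0 < τ) (j : ℕ) (H : Fin (n + 3) → ℝ) (hH : ∀ i, H i ≠ 0) :
    ∃ L : EuclideanSpace ℝ (Fin (n + 3)) ≃L[ℝ] (Fin (n + 3) → ℝ),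
      ∀ x i, L x i = (H i)⁻¹ * tilt τ i j x := by
  let T : EuclideanSpace ℝ (Fin (n + 3)) →ₗ[ℝ] (Fin (n + 3) → ℝ) :=
    LinearMap.pi fun i => (H i)⁻¹ • (tilt τ i j).toLinearMap
  have hT : Function.Injective T := by
    refine (injective_iff_map_eq_zero T).2 fun x hx => ?_
    have h : ∀ i, tilt τ i j x = 0 := fun i => by
      have : (H i)⁻¹ * tilt τ i j x = 0 := congrFun hx i
      exact (mul_eq_zero.1 this).resolve_left (inv_ne_zero (hH i))
    simp only [tilt_apply] at h
    have h0 := h 0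
    have h1 := h 1
    simp at h0 h1
    have hx1 : x 1 = 0 := by
      have : τ * x 1 = 0 := by linarith
      exact (mul_eq_zero.1 this).resolve_left hτ.ne'
    have hx2 : ∀ i : Fin (n + 3), 2 ≤ (i : ℕ) → x i = 0 := fun i hi => by
      have h2 := h i
      rw [hx1, if_pos hi] at h2
      have : τ * x i = 0 := by linarith
      exact (mul_eq_zero.1 this).resolve_left hτ.ne'
    have hx0 : x 0 = 0 := by
      rw [hx2 2 Fin.val_two.ge] at h0
      linarith
    ext i
    rcases Nat.lt_or_ge i 2 with hi | hi
    · rcases Nat.lt_or_ge i 1 with hi' | hi'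
      · obtain rfl : i = 0 := by apply Fin.ext; rw [Fin.val_zero]; omega
        exact hx0
      · obtain rfl : i = 1 := by apply Fin.ext; rw [Fin.val_one]; omega
        exact hx1
    · exact hx2 i hi
  refine ⟨(LinearMap.linearEquivOfInjective T hT (by simp)).toContinuousLinearEquiv,
    fun x i => rfl⟩

/-- The convex body obtained from `B` by scaling it by `1 + s` and intersecting with slabs. -/
theorem exists_unitBall_inter {ι : Type*} [Finite ι] {d : ℕ} (B : UnitBalls d) {s : ℝ} (hs : 0 < s)
    (f : ι → EuclideanSpace ℝ (Fin d) →L[ℝ] ℝ) :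
    ∃ B₁ : UnitBalls d, ((B₁ : NonemptyCompacts (EuclideanSpace ℝ (Fin d))) :
      Set (EuclideanSpace ℝ (Fin d))) = {x | (1 + s)⁻¹ • x ∈ B.1 ∧ ∀ k, |f k x| ≤ 1} := by
  have hs1 : 0 < 1 + s := by linarith
  set S : Set (EuclideanSpace ℝ (Fin d)) := {x | (1 + s)⁻¹ • x ∈ B.1 ∧ ∀ k, |f k x| ≤ 1} with hS
  have hSeq : S = ((1 + s) • (B.1 : Set (EuclideanSpace ℝ (Fin d)))) ∩ ⋂ k, {x | |f k x| ≤ 1} := by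
    ext x
    simp [hS, Set.mem_smul_set_iff_inv_smul_mem₀ hs1.ne']
  have hnhds : S ∈ 𝓝 0 := by
    rw [hSeq]
    refine inter_mem ((set_smul_mem_nhds_zero_iff hs1.ne').2 B.2.2.2) (iInter_mem.2 fun k => ?_)
    have hc : Continuous fun x => |f k x| := by fun_prop
    have : ∀ᶠ x in 𝓝 0, |f k x| < 1 := hc.continuousAt.eventually_lt continuousAt_const (by simp)
    filter_upwards [this] with x hx using hx.le
  have hcomp : IsCompact S := by
    rw [hSeq]
    refine (B.1.isCompact.smul _).inter_right (isClosed_iInter fun k => ?_)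
    exact isClosed_le (by fun_prop) continuous_const
  refine ⟨⟨⟨⟨S, hcomp⟩, ⟨0, mem_of_mem_nhds hnhds⟩⟩, ?_, ?_, hnhds⟩, rfl⟩
  · change Convex ℝ S
    rw [hSeq]
    refine (B.2.1.smul _).inter (convex_iInter fun k => ?_)
    have : {x | |f k x| ≤ 1} = f k ⁻¹' Set.Icc (-1) 1 := by
      ext x
      simp [abs_le]
    rw [this]
    exact (convex_Icc _ _).linear_preimage (f k).toLinearMap
  · change S = -S
    ext x
    have hB : ∀ y, y ∈ B.1 ↔ -y ∈ B.1 := fun y => by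
      have h : y ∈ (B.1 : Set (EuclideanSpace ℝ (Fin d))) ↔ y ∈ -(B.1 : Set _) := by
        rw [← B.2.2.1]
      exact h
    simp only [hS, Set.mem_neg, Set.mem_ofPred_eq, smul_neg, map_neg, abs_neg]
    rw [hB]

theorem dist_le_of_forall_inv_smul_mem {d : ℕ} (B B₁ : UnitBalls d) {s R : ℝ} (hs : 0 < s)
    (hR : ∀ x ∈ B.1, ‖x‖ ≤ R) (h : ∀ x ∈ B.1, (1 + s)⁻¹ • x ∈ B₁.1)
    (h₁ : ∀ x ∈ B₁.1, (1 + s)⁻¹ • x ∈ B.1) : dist B₁ B ≤ s * R := by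
  have hs1 : 0 < 1 + s := by linarith
  have hd : ∀ x : EuclideanSpace ℝ (Fin d),
      dist x ((1 + s)⁻¹ • x) = s * ‖(1 + s)⁻¹ • x‖ := fun x => by
    have e : x - (1 + s)⁻¹ • x = s • (1 + s)⁻¹ • x := by
      have : (1 : ℝ) - (1 + s)⁻¹ = s * (1 + s)⁻¹ := by
        field_simp
        ring
      rw [smul_smul, ← this, sub_smul, one_smul]
    rw [dist_eq_norm, e, norm_smul, Real.norm_of_nonneg hs.le]
  have hR0 : 0 ≤ R := (norm_nonneg _).trans (hR _ B.1.nonempty.choose_spec)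
  rw [Subtype.dist_eq, NonemptyCompacts.dist_eq]
  refine hausdorffDist_le_of_mem_dist (by positivity)
    (fun x hx => ⟨_, h₁ x hx, ?_⟩) (fun x hx => ⟨_, h x hx, ?_⟩)
  · rw [hd]
    exact mul_le_mul_of_nonneg_left (hR _ (h₁ x hx)) hs.le
  · rw [hd]
    refine mul_le_mul_of_nonneg_left ?_ hs.le
    rw [norm_smul, Real.norm_of_nonneg (by positivity)]
    refine (mul_le_of_le_one_left (norm_nonneg _) (inv_le_one_of_one_le₀ (by linarith))).trans
      (hR x hx)

end Construction

section Approximation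

variable {n : ℕ}

theorem continuous_euclideanSpace_single {ι : Type*} [Fintype ι] [DecidableEq ι] (i : ι) :
    Continuous fun a : ℝ => (EuclideanSpace.single i a : EuclideanSpace ℝ ι) := by
  have : (fun a : ℝ => (EuclideanSpace.single i a : EuclideanSpace ℝ ι)) =
      fun a => a • EuclideanSpace.single i 1 := by
    funext a
    ext k
    simp
  rw [this]
  fun_prop

theorem euclideanSpace_single_zero {ι : Type*} [DecidableEq ι] (i : ι) :
    (EuclideanSpace.single i (0 : ℝ) : EuclideanSpace ℝ ι) = 0 := by
  ext k
  simp

theorem continuous_commonPoint_sub_center (z : EuclideanSpace ℝ (Fin (n + 3))) (k : Fin (n + 3))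
    (l : ℕ) : Continuous fun τ : ℝ => commonPoint z τ l - center τ k := by
  have h : ∀ (i : Fin (n + 3)) (g : ℝ → ℝ), Continuous g →
      Continuous fun τ => (EuclideanSpace.single i (g τ) : EuclideanSpace ℝ (Fin (n + 3))) :=
    fun i g hg => (continuous_euclideanSpace_single i).comp hg
  have h0 := h 0 (fun τ => τ ^ 2 * l ^ 2) (by fun_prop)
  have h0' := h 0 (fun τ => τ ^ 2 * (k : ℕ) ^ 2) (by fun_prop)
  have h1 := h 1 (fun τ => τ * (k : ℕ)) (by fun_prop)
  have h2 := h 2 (fun τ => τ * l) (by fun_prop)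
  unfold commonPoint center
  fun_prop

theorem continuous_tilt_commonPoint_sub_center (z : EuclideanSpace ℝ (Fin (n + 3)))
    (i k : Fin (n + 3)) (j l : ℕ) :
    Continuous fun τ : ℝ => tilt τ i j (commonPoint z τ l - center τ k) := by
  simp only [tilt_commonPoint_sub_center]
  simp only [tilt_apply]
  fun_prop

theorem exists_max_coord (B : UnitBalls (n + 3)) :
    ∃ z ∈ B.1, 0 < z 0 ∧ ∀ x ∈ B.1, |x 0| ≤ z 0 := by
  have hcont : Continuous fun x : EuclideanSpace ℝ (Fin (n + 3)) => x 0 := by fun_prop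
  obtain ⟨z, hz, hmax⟩ := B.1.isCompact.exists_isMaxOn B.1.nonempty hcont.continuousOn
  refine ⟨z, hz, ?_, fun x hx => abs_le.2 ⟨?_, hmax hx⟩⟩
  · have h := (continuous_euclideanSpace_single (0 : Fin (n + 3))).tendsto 0
    rw [euclideanSpace_single_zero] at h
    have h' := (h.eventually (eventually_mem_set.2 B.2.2.2)).filter_mono (nhdsWithin_le_nhds (s := Set.Ioi 0))
    obtain ⟨a, ha, ha0⟩ := (h'.and self_mem_nhdsWithin).exists
    have h0 : (EuclideanSpace.single (0 : Fin (n + 3)) a) 0 ≤ z 0 := hmax ha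
    rw [PiLp.single_apply, if_pos rfl] at h0
    exact lt_of_lt_of_le ha0 h0
  · have hneg : -x ∈ (B.1 : Set (EuclideanSpace ℝ (Fin (n + 3)))) := by
      rw [B.2.2.1]
      simpa using hx
    have h0 : (-x) 0 ≤ z 0 := hmax hneg
    rw [PiLp.neg_apply] at h0
    linarith

theorem exists_tilt_bounds (B : UnitBalls (n + 3)) (m : ℕ) {s : ℝ} (hs : 0 < s) :
    ∃ (z : EuclideanSpace ℝ (Fin (n + 3))) (τ : ℝ), 0 < τ ∧
      (∀ (i k : Fin (n + 3)) (j l : Fin m), -tilt τ i j (commonPoint z τ j - center τ i) <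
        tilt τ i j (commonPoint z τ l - center τ k)) ∧
      (∀ (k : Fin (n + 3)) (l : Fin m), (1 + s)⁻¹ • (commonPoint z τ l - center τ k) ∈
        interior (B.1 : Set (EuclideanSpace ℝ (Fin (n + 3))))) ∧
      ∀ (i : Fin (n + 3)) (j : Fin m), ∀ x ∈ B.1, |tilt τ i j x| ≤
        (1 + s) * tilt τ i j (commonPoint z τ j - center τ i) := by
  obtain ⟨z, hz, hz0, hmax⟩ := exists_max_coord B
  obtain ⟨R, hR⟩ := B.1.isCompact.isBounded.exists_norm_le
  have htilt : ∀ (i k : Fin (n + 3)) (j l : ℕ),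
      tilt 0 i j (commonPoint z 0 l - center 0 k) = z 0 := fun i k j l => by
    rw [tilt_commonPoint_sub_center, tilt_apply]
    simp
  have hpt : ∀ (k : Fin (n + 3)) (l : ℕ), commonPoint z 0 l - center 0 k = z := fun k l => by
    simp [commonPoint, center, euclideanSpace_single_zero]
  have hcont := continuous_tilt_commonPoint_sub_center z
  have h1 : ∀ᶠ τ : ℝ in 𝓝 0, ∀ (i k : Fin (n + 3)) (j l : Fin m),
      -tilt τ i j (commonPoint z τ j - center τ i) <
        tilt τ i j (commonPoint z τ l - center τ k) := by
    simp only [eventually_all]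
    intro i k j l
    refine (hcont i i j j).fun_neg.continuousAt.eventually_lt (hcont i k j l).continuousAt ?_
    rw [htilt, htilt]
    linarith
  have h2 : ∀ᶠ τ : ℝ in 𝓝 0, ∀ (k : Fin (n + 3)) (l : Fin m),
      (1 + s)⁻¹ • (commonPoint z τ l - center τ k) ∈
        interior (B.1 : Set (EuclideanSpace ℝ (Fin (n + 3)))) := by
    simp only [eventually_all]
    intro k l
    refine ((continuous_commonPoint_sub_center z k l).fun_const_smul (1 + s)⁻¹).continuousAt
      |>.eventually_mem (isOpen_interior.mem_nhds ?_)
    rw [hpt, ← gauge_lt_one_iff_mem_interior B.2.1 B.2.2.2,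
      gauge_smul_of_nonneg (by positivity), smul_eq_mul]
    have hs' : (1 + s)⁻¹ < 1 := inv_lt_one_of_one_lt₀ (by linarith)
    have hs0 : 0 < (1 + s)⁻¹ := by positivity
    have hg : gauge (B.1 : Set (EuclideanSpace ℝ (Fin (n + 3)))) z ≤ 1 := gauge_le_one_of_mem hz
    nlinarith
  have h3 : ∀ᶠ τ : ℝ in 𝓝 0, ∀ (i : Fin (n + 3)) (j : Fin m),
      z 0 + τ * ((2 * (i : ℕ) + 2 * (j : ℕ) + 1) * R) <
        (1 + s) * tilt τ i j (commonPoint z τ j - center τ i) := by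
    simp only [eventually_all]
    intro i j
    refine ContinuousAt.eventually_lt (by fun_prop)
      (continuous_const.mul (hcont i i j j)).continuousAt ?_
    rw [htilt]
    nlinarith
  obtain ⟨τ, ⟨h1, h2, h3⟩, hτ⟩ := (((h1.and (h2.and h3)).filter_mono
    (nhdsWithin_le_nhds (s := Set.Ioi 0))).and self_mem_nhdsWithin).exists
  refine ⟨z, τ, hτ, h1, h2, fun i j x hx => ?_⟩
  have hτ : 0 < τ := hτ
  refine (abs_tilt_le hτ.le i j x).trans (le_trans ?_ (h3 i j).le)
  gcongr
  · exact hmax x hx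
  · exact hR x hx

theorem center_injective {τ : ℝ} (hτ : 0 < τ) :
    Function.Injective (center τ : Fin (n + 3) → EuclideanSpace ℝ (Fin (n + 3))) := by
  intro i k h
  have h1 := congrFun (congrArg WithLp.ofLp h) 1
  simp [center, hτ.ne'] at h1
  exact Fin.ext h1

theorem commonPoint_apply_two (z : EuclideanSpace ℝ (Fin (n + 3))) (τ : ℝ) (j : ℕ) :
    commonPoint z τ j 2 = z 2 + τ * j := by
  have h02 : (2 : Fin (n + 3)) ≠ 0 := by rw [Fin.ne_iff_vne, Fin.val_two]; simp
  simp [commonPoint, h02]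

theorem eq_of_mem_ball_commonPoint (z : EuclideanSpace ℝ (Fin (n + 3))) {τ : ℝ} (hτ : 0 < τ)
    {j l : ℕ} {x : EuclideanSpace ℝ (Fin (n + 3))} (hj : x ∈ ball (commonPoint z τ j) (τ / 2))
    (hl : x ∈ ball (commonPoint z τ l) (τ / 2)) : j = l := by
  have h : dist (commonPoint z τ j) (commonPoint z τ l) < τ := by
    rw [mem_ball, dist_comm] at hj
    have := (dist_triangle _ _ _).trans_lt (add_lt_add hj hl)
    linarith
  rw [dist_eq_norm] at h
  have h2 := (PiLp.norm_apply_le (commonPoint z τ j - commonPoint z τ l) 2).trans_lt h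
  rw [PiLp.sub_apply, commonPoint_apply_two, commonPoint_apply_two, add_sub_add_left_eq_sub,
    ← mul_sub, norm_mul, Real.norm_of_nonneg hτ.le, mul_lt_iff_lt_one_right hτ,
    Real.norm_eq_abs] at h2
  have h3 : |(j : ℤ) - l| < 1 := by exact_mod_cast h2
  have := Int.abs_lt_one_iff.1 h3
  omega

theorem exists_dist_lt_and_eventually_containsK (B : UnitBalls (n + 3)) (m : ℕ) {ε : ℝ}
    (hε : 0 < ε) :
    ∃ B₁ : UnitBalls (n + 3), dist B₁ B < ε ∧ ∀ᶠ B' : UnitBalls (n + 3) in 𝓝 B₁,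
      ContainsK (gauge (B'.1 : Set (EuclideanSpace ℝ (Fin (n + 3))))) (n + 3) m := by
  obtain ⟨R, hR0, hR⟩ := B.1.isCompact.isBounded.exists_pos_norm_le
  obtain ⟨s, hs, hsε⟩ : ∃ s : ℝ, 0 < s ∧ s * R < ε :=
    ⟨ε / 2 / R, by positivity, by rw [div_mul_cancel₀ _ hR0.ne']; linarith⟩
  obtain ⟨z, τ, hτ, hneg, hint, hbound⟩ := exists_tilt_bounds B m hs
  set H : Fin (n + 3) → Fin m → ℝ :=
    fun i j => tilt τ i j (commonPoint z τ j - center τ i) with hH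
  have hH0 : ∀ i j, 0 < H i j := fun i j => by
    have := hneg i i j j
    simp only [hH]
    linarith
  let f : Fin (n + 3) × Fin m → EuclideanSpace ℝ (Fin (n + 3)) →L[ℝ] ℝ :=
    fun p => (H p.1 p.2)⁻¹ • tilt τ p.1 p.2
  have hf : ∀ p x, f p x = (H p.1 p.2)⁻¹ * tilt τ p.1 p.2 x := fun p x => rfl
  obtain ⟨B₁, hB₁⟩ := exists_unitBall_inter B hs f
  have hmem : ∀ x, x ∈ B₁.1 ↔ (1 + s)⁻¹ • x ∈ B.1 ∧ ∀ k, |f k x| ≤ 1 := fun x => by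
    rw [← SetLike.mem_coe, hB₁]
    rfl
  have hs1 : 0 < 1 + s := by linarith
  refine ⟨B₁, (dist_le_of_forall_inv_smul_mem B B₁ hs hR (fun x hx => ?_)
    fun x hx => ((hmem x).1 hx).1).trans_lt hsε, ?_⟩
  · have hshrink : ∀ y ∈ B.1, (1 + s)⁻¹ • y ∈ B.1 := fun y hy =>
      B.2.1.smul_mem_of_zero_mem (mem_of_mem_nhds B.2.2.2) hy
        ⟨by positivity, inv_le_one_of_one_le₀ (by linarith)⟩
    refine (hmem _).2 ⟨hshrink _ (hshrink _ hx), fun p => ?_⟩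
    have h0 := hH0 p.1 p.2
    rw [hf, map_smul, smul_eq_mul, abs_mul, abs_mul, abs_of_pos (inv_pos.2 h0),
      abs_of_pos (inv_pos.2 hs1), inv_mul_le_iff₀ h0, inv_mul_le_iff₀ hs1, mul_one]
    exact hbound p.1 p.2 x hx
  have hlocal : ∀ (i : Fin (n + 3)) (j : Fin m),
      ∀ᶠ x in 𝓝 (commonPoint z τ j), gauge B₁.1.carrier (x - center τ i) =
        f (i, j) (x - center τ i) := by
    intro i j
    set q := commonPoint z τ j - center τ i with hq
    have hfq : f (i, j) q = 1 := by
      rw [hf]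
      exact inv_mul_cancel₀ (hH0 i j).ne'
    have hfc : ∀ p, ContinuousAt (fun x => f p x) q := fun p => (f p).continuous.continuousAt
    have h1 : ∀ᶠ x in 𝓝 q, 0 < f (i, j) x :=
      continuousAt_const.eventually_lt (hfc _) (by rw [hfq]; exact one_pos)
    have h2 : ∀ᶠ x in 𝓝 q, ∀ p, p ≠ (i, j) → |f p x| < f (i, j) x := by
      rw [eventually_all]
      intro p
      by_cases hp : p = (i, j)
      · simp [hp]
      have : ∀ᶠ x in 𝓝 q, |f p x| < f (i, j) x := by
        refine (hfc p).abs.eventually_lt (hfc _) ?_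
        have h0 := hH0 p.1 p.2
        have hlt : tilt τ p.1 p.2 q < H p.1 p.2 := tilt_lt_tilt z hτ fun e => hp (by
          rw [Prod.mk.injEq] at e
          exact Prod.ext e.1.symm (Fin.ext e.2.symm))
        rw [hfq, hf, abs_mul, abs_of_pos (inv_pos.2 h0), inv_mul_lt_iff₀ h0, mul_one, abs_lt]
        exact ⟨hneg p.1 i p.2 j, hlt⟩
      filter_upwards [this] with x hx _ using hx
    have h3 : ∀ᶠ x in 𝓝 q, (1 + s)⁻¹ • (f (i, j) x)⁻¹ • x ∈
        interior (B.1 : Set (EuclideanSpace ℝ (Fin (n + 3)))) := by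
      have hc : ContinuousAt (fun x => (1 + s)⁻¹ • (f (i, j) x)⁻¹ • x) q :=
        (((hfc _).fun_inv₀ (by rw [hfq]; exact one_ne_zero)).fun_smul
          continuousAt_id).fun_const_smul _
      refine hc.eventually_mem (isOpen_interior.mem_nhds ?_)
      rw [hfq, inv_one, one_smul]
      exact hint i j
    have key : ∀ᶠ x in 𝓝 q, gauge B₁.1.carrier x = f (i, j) x := by
      filter_upwards [h1, h2, h3] with x hx1 hx2 hx3
      refine gauge_eq_of_le_of_mem (absorbent_of_mem_unitBalls B₁)
        (fun y hy => (le_abs_self _).trans (((hmem y).1 hy).2 _)) hx1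
        ((hmem _).2 ⟨interior_subset hx3, fun p => ?_⟩)
      rw [map_smul, smul_eq_mul, abs_mul, abs_of_pos (inv_pos.2 hx1), inv_mul_le_iff₀ hx1, mul_one]
      by_cases hp : p = (i, j)
      · rw [hp, abs_of_pos hx1]
      · exact (hx2 p hp).le
    exact (continuous_sub_right (center τ i)).continuousAt.eventually key
  have hev : ∀ j : Fin m, ∀ᶠ B' : UnitBalls (n + 3) in 𝓝 B₁,
      ∃ x ∈ ball (commonPoint z τ j) (τ / 2), ∀ i,
        gauge B'.1.carrier (x - center τ i) = 1 := by
    intro j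
    obtain ⟨L, hL⟩ := exists_equiv_tilt hτ j (fun i => H i j) fun i => (hH0 i j).ne'
    have hLf : ∀ x i, L x i = f (i, j) x := hL
    refine eventually_exists_gauge_eq_one B₁ (center τ) _ L (fun i => -f (i, j) (center τ i)) ?_ ?_
      (half_pos hτ)
    · rw [eventually_all]
      intro i
      filter_upwards [hlocal i j] with x hx
      rw [hx, map_sub, hLf, sub_eq_add_neg]
    · intro i
      rw [hLf, ← sub_eq_add_neg, ← map_sub, hf]
      exact inv_mul_cancel₀ (hH0 i j).ne'
  filter_upwards [eventually_all.2 hev] with B' hB'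
  choose v hv hv1 using hB'
  refine ⟨center τ, v, center_injective hτ, fun j l h => ?_, fun i j => ⟨fun h => ?_, ?_⟩⟩
  · exact Fin.ext (eq_of_mem_ball_commonPoint z hτ (hv j) (h ▸ hv l))
  · have := hv1 j i
    rw [h, sub_self, gauge_zero] at this
    exact zero_ne_one this
  · rw [← hv1 j i, ← neg_sub]
    refine gauge_neg (fun x hx => ?_) _
    rw [B'.2.2.1] at hx
    exact hx

end Approximation

/-- For every integer d ≥ 3 and every integer m ≥ 1, there exists a subset
A_m ⊆ B_d that is open and dense in the Hausdorff metric such that for every unit ball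
B ∈ A_m, the unit distance graph of ‖·‖_B contains a copy of K_{d,m}. -/
theorem stmt2 (d : ℕ) (hd : 3 ≤ d) (m : ℕ) (hm : 1 ≤ m) :
    ∃ A : Set ↥(UnitBalls d), IsOpen A ∧ Dense A ∧
      ∀ B ∈ A,
        ContainsK (gauge ((B : TopologicalSpace.NonemptyCompacts (EuclideanSpace ℝ (Fin d))) :
          Set (EuclideanSpace ℝ (Fin d)))) d m := by
  obtain ⟨n, rfl⟩ : ∃ n, d = n + 3 := ⟨d - 3, by omega⟩
  let A : Set (UnitBalls (n + 3)) :=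
    {B | ContainsK (gauge (B.1 : Set (EuclideanSpace ℝ (Fin (n + 3))))) (n + 3) m}
  have hA : interior A ⊆ A := interior_subset
  refine ⟨interior A, isOpen_interior, Metric.dense_iff.2 fun B ε hε => ?_, fun B hB => hA hB⟩
  obtain ⟨B₁, hdist, hev⟩ := exists_dist_lt_and_eventually_containsK B m hε
  exact ⟨B₁, hdist, mem_interior_iff_mem_nhds.2 hev⟩
end
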